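/- arXiv:2604.10264 — 2 statements merged into one kernel-verified Lean document; each statement's English description precedes it below -/
import Mathlib

section
/- Let α ∈ (1,2], let s ∈ [1,∞) satisfy s·(2−α) ≤ 2, let s' be its conjugate exponent (1/s + 1/s' = 1), and let C₀ ≥ 1. For every ε > 0 there exists A > 0 such that for every δ ∈ (0,1), every Katz–Tao (δ,α,C₀)-set X ⊆ δℤ² ∩ B(0,1/4), every integer m ≥ 1, and every family (R_x)_{x∈X} of sets R_x ⊆ [1,2] ∩ δℤ with #R_x = m, one has ‖ Σ_{x∈X} Σ_{r∈R_x} 1_{S_{10δ}(x,r)} ‖_{L^{2}(ℝ²)} ≤ A·δ^{−ε}·(mδ)^{1/s'}·δ^{−α/2}·(#X)^{1/2}. -/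
open MeasureTheory Metric Set

/-- The `δ`-annulus `S_δ(x,r) = {y : ||y - x| - r| ≤ δ}`. -/
def annulus (δ : ℝ) (x : EuclideanSpace ℝ (Fin 2)) (r : ℝ) :
    Set (EuclideanSpace ℝ (Fin 2)) :=
  {y | |dist y x - r| ≤ δ}

/-- `X ⊆ δℤ²`: every coordinate of every point of `X` is an integer multiple of `δ`. -/
def InLattice (δ : ℝ) (X : Finset (EuclideanSpace ℝ (Fin 2))) : Prop :=
  ∀ z ∈ X, ∀ i : Fin 2, ∃ k : ℤ, z i = δ * k

/-- `X` is a Katz–Tao `(δ,α,C)`-set: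
`#(X ∩ B(x,r)) ≤ C·(r/δ)^α` for all `x` and all `r ∈ [δ,1]`. -/
def IsKatzTao (δ α C : ℝ) (X : Finset (EuclideanSpace ℝ (Fin 2))) : Prop :=
  ∀ (x : EuclideanSpace ℝ (Fin 2)) (r : ℝ), δ ≤ r → r ≤ 1 →
    (((X : Set (EuclideanSpace ℝ (Fin 2))) ∩ Metric.closedBall x r).ncard : ℝ)
      ≤ C * (r / δ) ^ α

/-- The sum of indicator functions of the `10δ`-annuli `S_{10δ}(x,r)`,
`x ∈ X`, `r ∈ R x`. -/
noncomputable def annSum (δ : ℝ) (X : Finset (EuclideanSpace ℝ (Fin 2)))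
    (R : EuclideanSpace ℝ (Fin 2) → Finset ℝ) (y : EuclideanSpace ℝ (Fin 2)) : ℝ :=
  ∑ x ∈ X, ∑ r ∈ R x, (annulus (10 * δ) x r).indicator (fun _ => (1 : ℝ)) y

theorem abs_second_difference_le {f f' f'' : ℝ → ℝ} {p q M : ℝ} (hq : 0 ≤ q)
    (hf : ∀ b ∈ Icc p (p + 2 * q), HasDerivAt f (f' b) b)
    (hf' : ∀ b ∈ Icc p (p + 2 * q), HasDerivAt f' (f'' b) b)
    (hM : ∀ b ∈ Icc p (p + 2 * q), |f'' b| ≤ M) :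
    |2 * f (p + q) - f p - f (p + 2 * q)| ≤ M * q ^ 2 := by
  have h1 : ∀ b ∈ Icc p (p + q), |f' (b + q) - f' b| ≤ M * q := by
    intro b hb
    have := (convex_Icc p (p + 2 * q)).norm_image_sub_le_of_norm_hasDerivWithin_le
      (fun x hx => (hf' x hx).hasDerivWithinAt) (fun x hx => by simpa using hM x hx)
      (x := b) (y := b + q) ⟨hb.1, by linarith [hb.2]⟩ ⟨by linarith [hb.1], by linarith [hb.2]⟩
    simpa [abs_of_nonneg hq] using this
  have h2 := (convex_Icc p (p + q)).norm_image_sub_le_of_norm_hasDerivWithin_le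
      (f := fun b => f (b + q) - f b) (f' := fun b => f' (b + q) - f' b) (C := M * q)
      (x := p) (y := p + q)
      (fun x hx => by
        have e1 := hf (x + q) ⟨by linarith [hx.1], by linarith [hx.2]⟩
        have e2 := hf x ⟨hx.1, by linarith [hx.2]⟩
        exact ((e1.comp_add_const x q).sub e2).hasDerivWithinAt)
      (fun x hx => by simpa using h1 x hx) 
      ⟨le_rfl, by linarith⟩ ⟨by linarith, le_rfl⟩
  simp only [Real.norm_eq_abs] at h2
  have e : p + q + q = p + 2 * q := by ring
  rw [e, show p + q - p = q by ring, abs_of_nonneg hq] at h2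
  calc _ = |f (p + 2 * q) - f (p + q) - (f (p + q) - f p)| := by
        rw [← abs_neg]; congr 1; ring
    _ ≤ _ := by rw [sq, ← mul_assoc]; exact h2

/-- The cosine of the angle between sides of lengths `a` and `t` in a triangle whose third side
has length `b`. -/
noncomputable def cosAngle (a t b : ℝ) : ℝ := (a ^ 2 + t ^ 2 - b ^ 2) / (2 * (a * t))

theorem abs_cosAngle_le {p q a t b : ℝ} (hq : 0 < q) (hp : 3 / 4 ≤ p + 2 * q) (hqt : 8 * q < t)
    (ht : t ≤ 1 / 2) (ha : a ∈ Icc p (p + 2 * q)) (hb : b ∈ Icc p (p + 2 * q)) :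
    |cosAngle a t b| ≤ 3 / 4 := by
  obtain ⟨ha1, ha2⟩ := ha
  obtain ⟨hb1, hb2⟩ := hb
  have ht0 : 0 < t := by linarith
  have ha0 : 5 / 8 ≤ a := by linarith
  have hb0 : 5 / 8 ≤ b := by linarith
  have hat : 0 < a * t := by positivity
  unfold cosAngle
  rw [abs_div, abs_of_pos (by positivity : 0 < 2 * (a * t)), div_le_iff₀ (by positivity), abs_le]
  have h1 : |a - b| ≤ t / 4 := by rw [abs_le]; constructor <;> linarith
  rw [abs_le] at h1
  have h2 : a + b ≤ 2 * a + t / 4 := by linarith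
  constructor
  · nlinarith [mul_nonneg (by linarith : 0 ≤ t / 4 + (a - b)) (by linarith : 0 ≤ a + b),
      sq_nonneg t]
  · nlinarith [mul_nonneg (by linarith : 0 ≤ t / 4 - (a - b)) (by linarith : 0 ≤ a + b),
      sq_nonneg t]

theorem hasDerivAt_cosAngle {a t : ℝ} (b : ℝ) :
    HasDerivAt (cosAngle a t) (-(b / (a * t))) b := by
  unfold cosAngle
  have h := ((hasDerivAt_pow 2 b).const_sub (a ^ 2 + t ^ 2)).div_const (2 * (a * t))
  convert! h using 1
  by_cases h0 : a * t = 0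
  · simp [h0]
  · field_simp
    simp [mul_comm]

theorem abs_arccos_cosAngle_second_difference_le {p q a t : ℝ} (hq : 0 < q)
    (hp : 3 / 4 ≤ p + 2 * q) (hqt : 8 * q < t) (ht : t ≤ 1 / 2) (ha : a ∈ Icc p (p + 2 * q)) :
    |2 * Real.arccos (cosAngle a t (p + q)) - Real.arccos (cosAngle a t p)
      - Real.arccos (cosAngle a t (p + 2 * q))| ≤ 32 / t ^ 2 * q ^ 2 := by
  have ht0 : 0 < t := by linarith
  have ha0 : 5 / 8 ≤ a := by linarith [ha.1]
  have hat : 0 < a * t := by positivity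
  have hc : ∀ b ∈ Icc p (p + 2 * q), |cosAngle a t b| ≤ 3 / 4 :=
    fun b hb => abs_cosAngle_le hq hp hqt ht ha hb
  have hs : ∀ b ∈ Icc p (p + 2 * q), 1 / 4 ≤ 1 - cosAngle a t b ^ 2 := by
    intro b hb
    have := abs_le.1 (hc b hb)
    nlinarith
  have hs' : ∀ b ∈ Icc p (p + 2 * q), 1 / 2 ≤ √(1 - cosAngle a t b ^ 2) := by
    intro b hb
    apply Real.le_sqrt_of_sq_le
    linarith [hs b hb]
  refine abs_second_difference_le (f := fun b => Real.arccos (cosAngle a t b))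
    (f' := fun b => (b / (a * t)) / √(1 - cosAngle a t b ^ 2))
    (f'' := fun b => (1 / (a * t)) / √(1 - cosAngle a t b ^ 2) -
      (b / (a * t)) ^ 2 * cosAngle a t b / √(1 - cosAngle a t b ^ 2) ^ 3) hq.le ?_ ?_ ?_
  · intro b hb
    have h := abs_le.1 (hc b hb)
    convert! (Real.hasDerivAt_arccos (x := cosAngle a t b) (by linarith) (by linarith)).comp b
      (hasDerivAt_cosAngle b) using 1
    ring
  · intro b hb
    have h1 := hs b hb
    have h2 := hs' b hb
    have hd := (((hasDerivAt_cosAngle (a := a) (t := t) b).pow 2).const_sub 1).sqrt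
      (by simp only [Pi.pow_apply]; linarith)
    have := ((hasDerivAt_id b).div_const (a * t)).div hd
      (by simp only [Pi.pow_apply]; linarith)
    convert! this using 1
    simp only [Pi.pow_apply, id]
    have h3 : √(1 - cosAngle a t b ^ 2) ≠ 0 := by linarith
    field_simp
    push_cast
    ring
  · intro b hb
    have h1 := hs' b hb
    have hb0 : 0 ≤ b := by linarith [hb.1]
    have hba : b ≤ 2 * a := by linarith [hb.2, ha.1]
    set S := √(1 - cosAngle a t b ^ 2)
    have hS : 0 < S := by linarith
    have e1 : |(1 / (a * t)) / S| ≤ 2 / t ^ 2 := by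
      rw [abs_of_pos (by positivity), div_div, div_le_div_iff₀ (by positivity) (by positivity)]
      nlinarith [mul_le_mul ha0 h1 (by norm_num) (by linarith), mul_pos hat hS]
    have e2 : |(b / (a * t)) ^ 2 * cosAngle a t b / S ^ 3| ≤ 24 / t ^ 2 := by
      have h8 : (1 / 8 : ℝ) ≤ S ^ 3 := by
        calc (1 / 8 : ℝ) = (1 / 2) ^ 3 := by norm_num
          _ ≤ S ^ 3 := by gcongr
      have h4 : (b / (a * t)) ^ 2 ≤ 4 / t ^ 2 := by
        rw [div_pow, div_le_div_iff₀ (by positivity) (by positivity)]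
        have : b ^ 2 ≤ (2 * a) ^ 2 := by gcongr
        nlinarith [mul_le_mul_of_nonneg_right this (sq_nonneg t)]
      rw [abs_div, abs_mul, abs_of_nonneg (sq_nonneg _), abs_of_pos (by positivity : 0 < S ^ 3)]
      calc _ ≤ 4 / t ^ 2 * (3 / 4) / (1 / 8) := by
            gcongr
            exact hc b hb
        _ = _ := by ring
    calc _ ≤ 2 / t ^ 2 + 24 / t ^ 2 := (abs_sub _ _).trans (add_le_add e1 e2)
      _ ≤ 32 / t ^ 2 := by rw [← add_div]; gcongr; norm_num

/-- The (unnormalised) Haar function of the interval `[p, p + 2q)`. -/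
noncomputable def haar (p q u : ℝ) : ℝ :=
  (Ico p (p + q)).indicator (fun _ => (1 : ℝ)) u -
    (Ico (p + q) (p + 2 * q)).indicator (fun _ => (1 : ℝ)) u

theorem measurable_haar (p q : ℝ) : Measurable (haar p q) :=
  (measurable_const.indicator measurableSet_Ico).sub
    (measurable_const.indicator measurableSet_Ico)

theorem haar_eq_zero {p q u : ℝ} (hq : 0 ≤ q) (hu : u ∉ Ico p (p + 2 * q)) : haar p q u = 0 := by
  simp only [mem_Ico, not_and_or, not_le, not_lt] at hu
  unfold haar
  rw [indicator_of_notMem, indicator_of_notMem, sub_zero] <;>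
      simp only [mem_Ico, not_and_or, not_le, not_lt] <;>
    rcases hu with h | h
  · left; linarith
  · right; linarith
  · left; linarith
  · right; linarith

theorem abs_haar_le_one (p q u : ℝ) : |haar p q u| ≤ 1 := by
  unfold haar
  by_cases h1 : u ∈ Ico p (p + q) <;> by_cases h2 : u ∈ Ico (p + q) (p + 2 * q) <;>
    simp [indicator, h1, h2]

theorem integral_haar_law_of_cosines_eq {p q a t : ℝ} (hq : 0 < q) (hp0 : 0 ≤ p)
    (hat : 0 < a * t) (hc : ∀ b ∈ Icc p (p + 2 * q), |cosAngle a t b| < 1) :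
    ∫ θ in Ioo (-Real.pi) Real.pi, haar p q √(a ^ 2 + t ^ 2 - 2 * (a * t) * Real.cos θ) =
      2 * (2 * Real.arccos (cosAngle a t (p + q)) - Real.arccos (cosAngle a t p)
      - Real.arccos (cosAngle a t (p + 2 * q))) := by
  set Θ : ℝ → ℝ := fun b => Real.arccos (cosAngle a t b) with hΘ
  have hmono : ∀ b b', 0 ≤ b → b ≤ b' → Θ b ≤ Θ b' := by
    intro b b' hb hbb'
    apply Real.arccos_le_arccos
    unfold cosAngle
    gcongr
  have hpos : ∀ b ∈ Icc p (p + 2 * q), 0 < Θ b := fun b hb =>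
    Real.arccos_pos.2 (abs_lt.1 (hc b hb)).2
  have hlt : ∀ b ∈ Icc p (p + 2 * q), Θ b < Real.pi := fun b hb => by
    rcases (Real.arccos_le_pi (cosAngle a t b)).lt_or_eq with h | h
    · exact h
    · rw [Real.arccos_eq_pi] at h
      linarith [(abs_lt.1 (hc b hb)).1]
  have m0 : p ∈ Icc p (p + 2 * q) := ⟨le_rfl, by linarith⟩
  have m1 : p + q ∈ Icc p (p + 2 * q) := ⟨by linarith, by linarith⟩
  have m2 : p + 2 * q ∈ Icc p (p + 2 * q) := ⟨by linarith, le_rfl⟩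
  have key : ∀ b ∈ Icc p (p + 2 * q), ∀ θ, |θ| ≤ Real.pi →
      (b ≤ √(a ^ 2 + t ^ 2 - 2 * (a * t) * Real.cos θ) ↔ Θ b ≤ |θ|) := by
    intro b hb θ hθ
    have hcb := abs_lt.1 (hc b hb)
    have hb0 : 0 ≤ b := hp0.trans hb.1
    have hnn : 0 ≤ a ^ 2 + t ^ 2 - 2 * (a * t) * Real.cos θ := by
      nlinarith [Real.cos_le_one θ, sq_nonneg (a - t)]
    rw [Real.le_sqrt hb0 hnn, ← Real.cos_abs θ]
    have : b ^ 2 ≤ a ^ 2 + t ^ 2 - 2 * (a * t) * Real.cos |θ| ↔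
        Real.cos |θ| ≤ cosAngle a t b := by
      unfold cosAngle
      rw [le_div_iff₀ (by positivity)]
      constructor <;> intro h <;> linarith
    rw [this, ← Real.cos_arccos hcb.1.le hcb.2.le]
    exact Real.strictAntiOn_cos.le_iff_ge ⟨abs_nonneg _, hθ⟩
      ⟨Real.arccos_nonneg _, Real.arccos_le_pi _⟩
  set G : ℝ → ℝ := fun u => (Ico (Θ p) (Θ (p + q))).indicator (fun _ => (1 : ℝ)) u -
    (Ico (Θ (p + q)) (Θ (p + 2 * q))).indicator (fun _ => (1 : ℝ)) u with hG
  have e1 : ∀ θ ∈ Ioo (-Real.pi) Real.pi,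
      haar p q √(a ^ 2 + t ^ 2 - 2 * (a * t) * Real.cos θ) = G |θ| := by
    intro θ hθ
    have hθ' : |θ| ≤ Real.pi := abs_le.2 ⟨hθ.1.le, hθ.2.le⟩
    simp only [haar, hG, indicator, mem_Ico]
    simp only [← not_le, key p m0 θ hθ', key _ m1 θ hθ', key _ m2 θ hθ']
  have hsupp : ∀ u, u ∉ Ico (Θ p) (Θ (p + 2 * q)) → G u = 0 := by
    intro u hu
    have l1 := hmono p (p + q) hp0 (by linarith)
    have l2 := hmono (p + q) (p + 2 * q) (by linarith) (by linarith)
    simp only [mem_Ico, not_and_or, not_le, not_lt] at hu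
    simp only [hG]
    rw [indicator_of_notMem, indicator_of_notMem, sub_zero] <;>
      simp only [mem_Ico, not_and_or, not_le, not_lt] <;> rcases hu with h | h
    · left; linarith
    · right; linarith
    · left; linarith
    · right; linarith
  rw [setIntegral_congr_fun measurableSet_Ioo e1, setIntegral_eq_integral_of_forall_compl_eq_zero,
    integral_comp_abs, setIntegral_eq_integral_of_forall_compl_eq_zero]
  · congr 1
    simp only [hG]
    rw [integral_sub, integral_indicator measurableSet_Ico, integral_indicator measurableSet_Ico]
    · simp only [integral_const, smul_eq_mul, mul_one, measureReal_restrict_apply_univ]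
      rw [Real.volume_real_Ico_of_le (hmono _ _ hp0 (by linarith)),
        Real.volume_real_Ico_of_le (hmono _ _ (by linarith) (by linarith))]
      ring
    · exact (integrable_indicator_iff measurableSet_Ico).2 (by simp)
    · exact (integrable_indicator_iff measurableSet_Ico).2 (by simp)
  · intro u hu
    refine hsupp u fun h => hu ?_
    exact (hpos p m0).trans_le h.1
  · intro u hu
    refine hsupp _ fun h => hu ?_
    exact abs_lt.1 (h.2.trans (hlt _ m2))

theorem abs_integral_haar_law_of_cosines_le {p q a t : ℝ} (hq : 0 < q)
    (hp : 3 / 4 ≤ p + 2 * q) (hqt : 8 * q < t) (ht : t ≤ 1 / 2) (ha : a ∈ Icc p (p + 2 * q)) :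
    |∫ θ in Ioo (-Real.pi) Real.pi, haar p q √(a ^ 2 + t ^ 2 - 2 * (a * t) * Real.cos θ)| ≤
      64 / t ^ 2 * q ^ 2 := by
  have ht0 : 0 < t := by linarith
  have ha0 : 5 / 8 ≤ a := by linarith [ha.1]
  rw [integral_haar_law_of_cosines_eq hq (by linarith) (by positivity)
    (fun b hb => (abs_cosAngle_le hq hp hqt ht ha hb).trans_lt (by norm_num)), abs_mul, abs_two]
  calc _ ≤ 2 * (32 / t ^ 2 * q ^ 2) := by
        gcongr
        exact abs_arccos_cosAngle_second_difference_le hq hp hqt ht ha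
    _ = _ := by ring

theorem exists_linearIsometryEquiv_complex (v : EuclideanSpace ℝ (Fin 2)) :
    ∃ f : EuclideanSpace ℝ (Fin 2) ≃ₗᵢ[ℝ] ℂ, f v = ((‖v‖ : ℝ) : ℂ) := by
  set g := Complex.orthonormalBasisOneI.repr.symm
  refine ⟨g.trans (rotation (Circle.exp (-(g v).arg))), ?_⟩
  rw [LinearIsometryEquiv.trans_apply, rotation_apply, Circle.coe_exp]
  have h := Complex.norm_mul_exp_arg_mul_I (g v)
  calc _ = Complex.exp (((-(g v).arg : ℝ) : ℂ) * Complex.I) *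
        (‖g v‖ * Complex.exp ((g v).arg * Complex.I)) := by rw [h]
    _ = _ := by
      rw [mul_left_comm, ← Complex.exp_add]
      simp

theorem norm_polarCoord_symm_sub_ofReal (a t θ : ℝ) :
    ‖Complex.polarCoord.symm (a, θ) - (t : ℂ)‖ =
      √(a ^ 2 + t ^ 2 - 2 * (a * t) * Real.cos θ) := by
  rw [Complex.polarCoord_symm_apply, Complex.norm_eq_sqrt_sq_add_sq]
  congr 1
  simp only [Complex.sub_re, Complex.mul_re, Complex.ofReal_re, Complex.add_re, Complex.I_re,
    mul_zero, Complex.ofReal_im, Complex.I_im, mul_one, sub_self, add_zero, Complex.add_im,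
    Complex.mul_im, zero_add, zero_mul, sub_zero, Complex.sub_im]
  linear_combination a ^ 2 * Real.sin_sq_add_cos_sq θ

theorem integral_haar_mul_haar_eq_complex (p q : ℝ) (x x' : EuclideanSpace ℝ (Fin 2)) :
    ∫ y, haar p q (dist y x) * haar p q (dist y x') =
      ∫ w : ℂ, haar p q ‖w‖ * haar p q ‖w - (dist x x' : ℂ)‖ := by
  obtain ⟨f, hf⟩ := exists_linearIsometryEquiv_complex (x' - x)
  rw [← integral_add_right_eq_self _ x]
  rw [← f.measurePreserving.integral_comp f.toHomeomorph.measurableEmbedding]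
  congr 1
  ext y
  have h1 : dist (y + x) x = ‖f y‖ := by rw [dist_eq_norm, add_sub_cancel_right, f.norm_map]
  have h2 : dist (y + x) x' = ‖f y - (dist x x' : ℂ)‖ := by
    rw [dist_comm x x', dist_eq_norm x' x, ← hf, ← map_sub, f.norm_map, dist_eq_norm]
    congr 1
    abel
  rw [h1, h2]

theorem integral_haar_mul_haar_eq_polar {p q : ℝ} (hq : 0 ≤ q)
    (x x' : EuclideanSpace ℝ (Fin 2)) :
    ∫ y, haar p q (dist y x) * haar p q (dist y x') =
      ∫ a in Ioi (0 : ℝ), a * haar p q a * ∫ θ in Ioo (-Real.pi) Real.pi,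
        haar p q √(a ^ 2 + dist x x' ^ 2 - 2 * (a * dist x x') * Real.cos θ) := by
  set t := dist x x'
  rw [integral_haar_mul_haar_eq_complex, ← Complex.integral_comp_polarCoord_symm,
    polarCoord_target]
  have e1 : ∀ z ∈ Ioi (0 : ℝ) ×ˢ Ioo (-Real.pi) Real.pi,
      z.1 • (haar p q ‖Complex.polarCoord.symm z‖ *
        haar p q ‖Complex.polarCoord.symm z - (t : ℂ)‖) =
      z.1 * haar p q z.1 *
        haar p q √(z.1 ^ 2 + t ^ 2 - 2 * (z.1 * t) * Real.cos z.2) := by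
    rintro ⟨a, θ⟩ ⟨ha, -⟩
    rw [norm_polarCoord_symm_sub_ofReal, Complex.norm_polarCoord_symm,
      abs_of_pos (by simpa using ha), smul_eq_mul, ← mul_assoc]
  rw [setIntegral_congr_fun (measurableSet_Ioi.prod measurableSet_Ioo) e1, Measure.volume_eq_prod,
    setIntegral_prod]
  · simp only [integral_const_mul]
  · have hI : IntegrableOn (fun z : ℝ × ℝ => z.1 * haar p q z.1 *
        haar p q √(z.1 ^ 2 + t ^ 2 - 2 * (z.1 * t) * Real.cos z.2))
        (Ico p (p + 2 * q) ×ˢ Ioo (-Real.pi) Real.pi) := by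
      refine Measure.integrableOn_of_bounded (M := |p| + |p + 2 * q|) ?_ ?_ ?_
      · rw [Measure.volume_eq_prod, Measure.prod_prod]
        simp [ENNReal.mul_eq_top]
      · refine Measurable.aestronglyMeasurable ?_
        refine (measurable_fst.mul ((measurable_haar p q).comp measurable_fst)).mul
          ((measurable_haar p q).comp ?_)
        exact Continuous.measurable (by fun_prop)
      · refine (ae_restrict_iff' (measurableSet_Ico.prod measurableSet_Ioo)).2 (ae_of_all _ ?_)
        rintro ⟨a, θ⟩ ⟨ha, -⟩
        simp only [mem_Ico] at ha
        rw [norm_mul, norm_mul, Real.norm_eq_abs, Real.norm_eq_abs, Real.norm_eq_abs]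
        have h1 : |a| ≤ |p| + |p + 2 * q| := by
          rw [abs_le]
          constructor
          · linarith [neg_abs_le p, abs_nonneg (p + 2 * q)]
          · linarith [le_abs_self (p + 2 * q), abs_nonneg p]
        calc _ ≤ |a| * 1 * 1 := by gcongr <;> exact abs_haar_le_one _ _ _
          _ ≤ _ := by linarith
    refine hI.of_forall_sdiff_eq_zero (measurableSet_Ioi.prod measurableSet_Ioo) ?_
    rintro ⟨a, θ⟩ ⟨⟨-, hθ⟩, h⟩
    have : a ∉ Ico p (p + 2 * q) := fun ha => h ⟨ha, hθ⟩
    simp [haar_eq_zero hq this]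

theorem abs_integral_haar_mul_haar_le_of_angular {p q B : ℝ} (hq : 0 < q) (hp : 0 ≤ p + 2 * q)
    (hB0 : 0 ≤ B) (x x' : EuclideanSpace ℝ (Fin 2))
    (hB : ∀ a ∈ Ico p (p + 2 * q), 0 < a → |∫ θ in Ioo (-Real.pi) Real.pi,
        haar p q √(a ^ 2 + dist x x' ^ 2 - 2 * (a * dist x x') * Real.cos θ)| ≤ B) :
    |∫ y, haar p q (dist y x) * haar p q (dist y x')| ≤ (p + 2 * q) * B * (2 * q) := by
  rw [integral_haar_mul_haar_eq_polar hq.le,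
    setIntegral_eq_of_subset_of_forall_sdiff_eq_zero (t := Ioi 0)
      (s := Ioi 0 ∩ Ico p (p + 2 * q)) measurableSet_Ioi inter_subset_left]
  · have hle : volume (Ioi 0 ∩ Ico p (p + 2 * q)) ≤ volume (Ico p (p + 2 * q)) :=
      measure_mono inter_subset_right
    rw [← Real.norm_eq_abs]
    refine (norm_setIntegral_le_of_norm_le_const (C := (p + 2 * q) * B) ?_ ?_).trans ?_
    · exact hle.trans_lt measure_Ico_lt_top
    · rintro a ⟨ha0, ha⟩
      have ha0' : 0 < a := ha0
      rw [norm_mul, norm_mul, Real.norm_eq_abs, Real.norm_eq_abs, Real.norm_eq_abs, abs_of_pos ha0']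
      calc a * |haar p q a| * _ ≤ (p + 2 * q) * 1 * B := by
            gcongr
            · exact ha.2.le
            · exact abs_haar_le_one _ _ _
            · exact hB a ha ha0'
        _ = _ := by ring
    · gcongr
      refine (measureReal_mono inter_subset_right measure_Ico_lt_top.ne).trans ?_
      rw [Real.volume_real_Ico_of_le (by linarith)]
      linarith
  · rintro a ⟨ha0, ha⟩
    have : a ∉ Ico p (p + 2 * q) := fun h => ha ⟨ha0, h⟩
    simp [haar_eq_zero hq.le this]

theorem abs_integral_haar_mul_haar_le {p q : ℝ} (hq : 0 < q) (hp : 0 ≤ p + 2 * q)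
    (hp4 : p + 2 * q ≤ 4) (x x' : EuclideanSpace ℝ (Fin 2)) :
    |∫ y, haar p q (dist y x) * haar p q (dist y x')| ≤ 64 * q := by
  refine (abs_integral_haar_mul_haar_le_of_angular (B := 2 * Real.pi) hq hp (by positivity)
    x x' ?_).trans ?_
  · intro a _ _
    rw [← Real.norm_eq_abs]
    refine (norm_setIntegral_le_of_norm_le_const (C := 1)
      (s := Ioo (-Real.pi) Real.pi) (μ := volume) (by simp)
      (fun θ _ => abs_haar_le_one _ _ _)).trans ?_
    rw [Real.volume_real_Ioo_of_le (by linarith [Real.pi_pos])]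
    linarith
  · calc (p + 2 * q) * (2 * Real.pi) * (2 * q) ≤ 4 * (2 * 4) * (2 * q) := by
          gcongr
          exact Real.pi_le_four
      _ = _ := by ring

theorem abs_integral_haar_mul_haar_mul_sq_le {p q : ℝ} (hq : 0 < q) (hp : 3 / 4 ≤ p + 2 * q)
    (hp4 : p + 2 * q ≤ 4) {x x' : EuclideanSpace ℝ (Fin 2)} (hx : dist x x' ≤ 1 / 2) :
    |∫ y, haar p q (dist y x) * haar p q (dist y x')| * dist x x' ^ 2 ≤ 4096 * q ^ 3 := by
  rcases le_or_gt (dist x x') (8 * q) with h | h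
  · calc _ ≤ (64 * q) * (8 * q) ^ 2 := by
          gcongr
          exact abs_integral_haar_mul_haar_le hq (by linarith) hp4 x x'
      _ = _ := by ring
  · have ht : 0 < dist x x' := by linarith
    rw [← le_div_iff₀ (by positivity)]
    refine (abs_integral_haar_mul_haar_le_of_angular (B := 64 / dist x x' ^ 2 * q ^ 2) hq
      (by linarith) (by positivity) x x' ?_).trans ?_
    · intro a ha _
      exact abs_integral_haar_law_of_cosines_le hq hp h hx ⟨ha.1, ha.2.le⟩
    · calc (p + 2 * q) * (64 / dist x x' ^ 2 * q ^ 2) * (2 * q)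
          ≤ 4 * (64 / dist x x' ^ 2 * q ^ 2) * (2 * q) := by gcongr
        _ = 512 * q ^ 3 / dist x x' ^ 2 := by ring
        _ ≤ _ := by gcongr; norm_num

theorem integrable_haar_mul_haar {p q : ℝ} (hq : 0 ≤ q) (x x' : EuclideanSpace ℝ (Fin 2)) :
    Integrable fun y => haar p q (dist y x) * haar p q (dist y x') := by
  have hI : IntegrableOn (fun y => haar p q (dist y x) * haar p q (dist y x'))
      (closedBall x (p + 2 * q)) := by
    refine Measure.integrableOn_of_bounded (M := 1) measure_closedBall_lt_top.ne ?_ ?_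
    · refine Measurable.aestronglyMeasurable ?_
      exact ((measurable_haar p q).comp (measurable_id.dist measurable_const)).mul
        ((measurable_haar p q).comp (measurable_id.dist measurable_const))
    · refine ae_of_all _ fun y => ?_
      rw [norm_mul]
      exact mul_le_one₀ (abs_haar_le_one _ _ _) (norm_nonneg _) (abs_haar_le_one _ _ _)
  refine (integrableOn_iff_integrable_of_support_subset fun y hy => ?_).1 hI
  by_contra h
  rw [mem_closedBall, not_le] at h
  refine hy ?_
  simp only
  rw [haar_eq_zero hq (fun h' => (h'.2.trans h).false), zero_mul]

theorem sq_sum_haar_eq (p q : ℝ) (X : Finset (EuclideanSpace ℝ (Fin 2)))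
    (c : EuclideanSpace ℝ (Fin 2) → ℝ) (y : EuclideanSpace ℝ (Fin 2)) :
    (∑ x ∈ X, c x * haar p q (dist y x)) ^ 2 =
      ∑ x ∈ X, ∑ x' ∈ X, c x * c x' * (haar p q (dist y x) * haar p q (dist y x')) := by
  rw [sq, Finset.sum_mul_sum]
  exact Finset.sum_congr rfl fun x _ => Finset.sum_congr rfl fun x' _ => by ring

theorem integrable_sq_sum_haar {p q : ℝ} (hq : 0 ≤ q) (X : Finset (EuclideanSpace ℝ (Fin 2)))
    (c : EuclideanSpace ℝ (Fin 2) → ℝ) :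
    Integrable fun y => (∑ x ∈ X, c x * haar p q (dist y x)) ^ 2 := by
  simp only [sq_sum_haar_eq]
  exact integrable_finsetSum _ fun x _ => integrable_finsetSum _ fun x' _ =>
    (integrable_haar_mul_haar hq x x').const_mul _

/-- Schur's test for the Gram matrix of radial Haar functions. -/
theorem integral_sq_sum_haar_le {p q S : ℝ} (hq : 0 ≤ q)
    (X : Finset (EuclideanSpace ℝ (Fin 2))) (c : EuclideanSpace ℝ (Fin 2) → ℝ)
    (hS : ∀ x ∈ X, ∑ x' ∈ X, |∫ y, haar p q (dist y x) * haar p q (dist y x')| ≤ S) :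
    ∫ y, (∑ x ∈ X, c x * haar p q (dist y x)) ^ 2 ≤ S * ∑ x ∈ X, c x ^ 2 := by
  set G : EuclideanSpace ℝ (Fin 2) → EuclideanSpace ℝ (Fin 2) → ℝ :=
    fun x x' => |∫ y, haar p q (dist y x) * haar p q (dist y x')| with hG
  have hsymm : ∀ x x', G x x' = G x' x := fun x x' => by simp only [hG, mul_comm]
  have e : ∫ y, (∑ x ∈ X, c x * haar p q (dist y x)) ^ 2 =
      ∑ x ∈ X, ∑ x' ∈ X, c x * c x' * ∫ y, haar p q (dist y x) * haar p q (dist y x') := by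
    simp only [sq_sum_haar_eq]
    rw [integral_finsetSum]
    · refine Finset.sum_congr rfl fun x _ => ?_
      rw [integral_finsetSum]
      · exact Finset.sum_congr rfl fun x' _ => integral_const_mul _ _
      · exact fun x' _ => (integrable_haar_mul_haar hq x x').const_mul _
    · exact fun x _ => integrable_finsetSum _ fun x' _ =>
        (integrable_haar_mul_haar hq x x').const_mul _
  rw [e]
  have h1 : ∀ x x', c x * c x' * ∫ y, haar p q (dist y x) * haar p q (dist y x') ≤
      1 / 2 * (c x ^ 2 * G x x') + 1 / 2 * (c x' ^ 2 * G x' x) := by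
    intro x x'
    rw [hsymm x' x]
    have hle : |c x * c x'| ≤ (c x ^ 2 + c x' ^ 2) / 2 := by
      rw [abs_le]
      constructor <;> nlinarith [sq_nonneg (c x + c x'), sq_nonneg (c x - c x')]
    calc _ ≤ |c x * c x'| * G x x' := by
          rw [← abs_mul]
          exact le_abs_self _
      _ ≤ (c x ^ 2 + c x' ^ 2) / 2 * G x x' := by
          gcongr
      _ = _ := by ring
  have h2 : ∑ x ∈ X, ∑ x' ∈ X, c x ^ 2 * G x x' ≤ S * ∑ x ∈ X, c x ^ 2 := by
    rw [Finset.mul_sum]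
    refine Finset.sum_le_sum fun x hx => ?_
    rw [← Finset.mul_sum, mul_comm]
    exact mul_le_mul_of_nonneg_right (hS x hx) (sq_nonneg _)
  calc _ ≤ ∑ x ∈ X, ∑ x' ∈ X,
        (1 / 2 * (c x ^ 2 * G x x') + 1 / 2 * (c x' ^ 2 * G x' x)) :=
        Finset.sum_le_sum fun x _ => Finset.sum_le_sum fun x' _ => h1 x x'
    _ = 1 / 2 * ∑ x ∈ X, ∑ x' ∈ X, c x ^ 2 * G x x' +
        1 / 2 * ∑ x ∈ X, ∑ x' ∈ X, c x ^ 2 * G x x' := by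
        simp only [Finset.sum_add_distrib, ← Finset.mul_sum]
        rw [Finset.sum_comm (f := fun x x' => c x' ^ 2 * G x' x)]
        simp only [← Finset.mul_sum]
    _ ≤ _ := by linarith

theorem le_sum_dyadic_of_mul_sq_le {v t A : ℝ} (k : ℕ) (ht1 : t ≤ 1) (hA : 0 ≤ A)
    (h0 : v ≤ A) (h1 : v * t ^ 2 ≤ A * (1 / 4) ^ k) :
    v ≤ 4 * A * ∑ j ∈ Finset.range (k + 1),
      (1 / 4) ^ (k - j) * if t ≤ (1 / 2) ^ j then 1 else 0 := by
  have hnn : ∀ j ∈ Finset.range (k + 1),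
      (0 : ℝ) ≤ (1 / 4) ^ (k - j) * if t ≤ (1 / 2) ^ j then 1 else 0 := fun j _ => by
    split_ifs <;> simp
  have hex : ∀ k : ℕ, t ≤ (1 / 2) ^ k ∨ ∃ j < k, (1 / 2) ^ (j + 1) < t ∧ t ≤ (1 / 2) ^ j := by
    intro k
    induction k with
    | zero => left; simpa using ht1
    | succ k ih =>
      rcases ih with h | ⟨j, hj, h⟩
      · by_cases h' : t ≤ (1 / 2) ^ (k + 1)
        · exact Or.inl h'
        · exact Or.inr ⟨k, by omega, not_le.1 h', h⟩
      · exact Or.inr ⟨j, by omega, h⟩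
  rcases hex k with h | ⟨j, hj, hlt, hle⟩
  · have := Finset.single_le_sum hnn (Finset.mem_range.2 (Nat.lt_succ_self k))
    rw [if_pos h] at this
    simp only [tsub_self, pow_zero, mul_one] at this
    nlinarith
  · have := Finset.single_le_sum hnn (Finset.mem_range.2 (by omega : j < k + 1))
    rw [if_pos hle, mul_one] at this
    have h4 : (1 / 4 : ℝ) ^ (j + 1) ≤ t ^ 2 := by
      calc (1 / 4 : ℝ) ^ (j + 1) = ((1 / 2) ^ (j + 1)) ^ 2 := by
            rw [← pow_mul, mul_comm, pow_mul]; norm_num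
        _ ≤ t ^ 2 := by gcongr
    refine le_trans ?_ (mul_le_mul_of_nonneg_left this (by positivity))
    have hk : (1 / 4 : ℝ) ^ k = (1 / 4) ^ (k - j) * (1 / 4) ^ j := by
      rw [← pow_add]; congr 1; omega
    rcases le_or_gt v 0 with hv | hv
    · exact hv.trans (by positivity)
    have h5 : v * (1 / 4) ^ (j + 1) ≤ A * ((1 / 4) ^ (k - j) * (1 / 4) ^ j) := by
      rw [← hk]
      exact (mul_le_mul_of_nonneg_left h4 hv.le).trans h1
    have h6 : (0 : ℝ) < (1 / 4) ^ j := by positivity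
    rw [pow_succ] at h5
    refine le_of_mul_le_mul_right (a := (1 / 4 : ℝ) ^ j) ?_ h6
    nlinarith

theorem IsKatzTao.card_filter_le {δ α C : ℝ} {X : Finset (EuclideanSpace ℝ (Fin 2))}
    (hX : IsKatzTao δ α C X) (x : EuclideanSpace ℝ (Fin 2)) {r : ℝ} (hδr : δ ≤ r) (hr : r ≤ 1) :
    ∑ x' ∈ X, (if dist x x' ≤ r then (1 : ℝ) else 0) ≤ C * (r / δ) ^ α := by
  classical
  refine le_trans (le_of_eq ?_) (hX x r hδr hr)
  rw [Finset.sum_ite, Finset.sum_const_zero, add_zero, Finset.sum_const, nsmul_eq_mul, mul_one,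
    ← Set.ncard_coe_finset]
  congr 2
  ext z
  simp [dist_comm]

theorem sum_abs_integral_haar_mul_haar_le {δ α C : ℝ} (hδ : 0 < δ) (hα : α ≤ 2) (hC : 0 ≤ C)
    {X : Finset (EuclideanSpace ℝ (Fin 2))} (hX : IsKatzTao δ α C X)
    (hX1 : (X : Set (EuclideanSpace ℝ (Fin 2))) ⊆ closedBall 0 (1 / 4)) {k : ℕ}
    (hk : δ ≤ (1 / 2) ^ k) {p : ℝ} (hp : 3 / 4 ≤ p + (1 / 2) ^ k) (hp4 : p + (1 / 2) ^ k ≤ 4)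
    {x : EuclideanSpace ℝ (Fin 2)} (hx : x ∈ X) :
    ∑ x' ∈ X, |∫ y, haar p ((1 / 2) ^ (k + 1)) (dist y x) *
        haar p ((1 / 2) ^ (k + 1)) (dist y x')| ≤
      8192 * (k + 1) * C * (1 / 2) ^ k * ((1 / 2) ^ k / δ) ^ α := by
  set q : ℝ := (1 / 2) ^ (k + 1) with hq
  have hq0 : 0 < q := by positivity
  have h2q : (1 / 2 : ℝ) ^ k = 2 * q := by rw [hq, pow_succ]; ring
  rw [h2q] at hp hp4
  have hA : ∀ x' ∈ X, |∫ y, haar p q (dist y x) * haar p q (dist y x')| ≤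
      4 * (4096 * q) * ∑ j ∈ Finset.range (k + 1),
        (1 / 4) ^ (k - j) * if dist x x' ≤ (1 / 2) ^ j then 1 else 0 := by
    intro x' hx'
    have hd : dist x x' ≤ 1 / 2 := by
      have h1 := hX1 hx
      have h2 := hX1 hx'
      rw [mem_closedBall] at h1 h2
      linarith [dist_triangle_right x x' 0]
    refine le_sum_dyadic_of_mul_sq_le k (by linarith) (by positivity) ?_ ?_
    · exact (abs_integral_haar_mul_haar_le hq0 (by linarith) hp4 x x').trans
        (by linarith)
    · refine (abs_integral_haar_mul_haar_mul_sq_le hq0 hp hp4 hd).trans ?_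
      have : (1 / 4 : ℝ) ^ k = (2 * q) ^ 2 := by
        rw [← h2q, ← pow_mul, mul_comm, pow_mul]; norm_num
      rw [this]
      nlinarith [pow_pos hq0 3]
  have hterm : ∀ j ∈ Finset.range (k + 1),
      (1 / 4 : ℝ) ^ (k - j) * (C * ((1 / 2) ^ j / δ) ^ α) ≤ C * ((1 / 2) ^ k / δ) ^ α := by
    intro j hj
    have hjk : j ≤ k := by simpa [Nat.lt_succ_iff] using hj
    have e1 : (1 / 2 : ℝ) ^ j / δ = 2 ^ (k - j) * ((1 / 2) ^ k / δ) := by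
      obtain ⟨i, rfl⟩ := Nat.exists_eq_add_of_le hjk
      rw [Nat.add_sub_cancel_left, pow_add]
      have : (2 : ℝ) ^ i * (1 / 2) ^ i = 1 := by rw [← mul_pow]; norm_num
      calc (1 / 2 : ℝ) ^ j / δ = (2 ^ i * (1 / 2) ^ i) * (1 / 2 : ℝ) ^ j / δ := by
            rw [this, one_mul]
        _ = _ := by ring
    rw [e1, Real.mul_rpow (by positivity) (by positivity)]
    have e2 : ((2 : ℝ) ^ (k - j)) ^ α ≤ 4 ^ (k - j) := by
      calc ((2 : ℝ) ^ (k - j)) ^ α ≤ ((2 : ℝ) ^ (k - j)) ^ (2 : ℝ) :=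
            Real.rpow_le_rpow_of_exponent_le (one_le_pow₀ (by norm_num)) hα
        _ = 4 ^ (k - j) := by
            rw [Real.rpow_two, ← pow_mul, mul_comm, pow_mul]; norm_num
    have e3 : (1 / 4 : ℝ) ^ (k - j) * 4 ^ (k - j) = 1 := by rw [← mul_pow]; norm_num
    calc _ ≤ (1 / 4 : ℝ) ^ (k - j) * (C * (4 ^ (k - j) * ((1 / 2) ^ k / δ) ^ α)) := by gcongr
      _ = ((1 / 4 : ℝ) ^ (k - j) * 4 ^ (k - j)) * (C * ((1 / 2) ^ k / δ) ^ α) := by ring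
      _ = _ := by rw [e3, one_mul]
  calc _ ≤ ∑ x' ∈ X, 4 * (4096 * q) * ∑ j ∈ Finset.range (k + 1),
        (1 / 4) ^ (k - j) * (if dist x x' ≤ (1 / 2) ^ j then (1 : ℝ) else 0) :=
        Finset.sum_le_sum hA
    _ = 4 * (4096 * q) * ∑ j ∈ Finset.range (k + 1),
        (1 / 4) ^ (k - j) * ∑ x' ∈ X, (if dist x x' ≤ (1 / 2) ^ j then (1 : ℝ) else 0) := by
        rw [← Finset.mul_sum, Finset.sum_comm]
        simp only [← Finset.mul_sum]
    _ ≤ 4 * (4096 * q) * ∑ j ∈ Finset.range (k + 1),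
        (1 / 4) ^ (k - j) * (C * ((1 / 2) ^ j / δ) ^ α) := by
        gcongr with j hj
        refine hX.card_filter_le x (hk.trans ?_) (pow_le_one₀ (by norm_num) (by norm_num))
        exact pow_le_pow_of_le_one (by norm_num) (by norm_num)
          (by simpa [Nat.lt_succ_iff] using hj)
    _ ≤ 4 * (4096 * q) * ∑ j ∈ Finset.range (k + 1), C * ((1 / 2) ^ k / δ) ^ α := by
        exact mul_le_mul_of_nonneg_left (Finset.sum_le_sum hterm) (by positivity)
    _ = _ := by
        rw [Finset.sum_const, Finset.card_range, nsmul_eq_mul, h2q]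
        push_cast
        ring

/-- The average of `h` over the pair of children `2n`, `2n + 1` of the dyadic index `n`. -/
noncomputable def dyadicAvg (h : ℤ → ℝ) (n : ℤ) : ℝ := (h (2 * n) + h (2 * n + 1)) / 2

/-- Half the difference of `h` over the pair of children `2n`, `2n + 1` of the dyadic index
`n`. -/
noncomputable def dyadicDiff (h : ℤ → ℝ) (n : ℤ) : ℝ := (h (2 * n) - h (2 * n + 1)) / 2

theorem haar_dyadic_eq_zero {k : ℕ} {n : ℤ} {u : ℝ} (hn : n ≠ ⌊2 ^ k * u⌋) :
    haar (n * (1 / 2) ^ k) ((1 / 2) ^ (k + 1)) u = 0 := by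
  refine haar_eq_zero (by positivity) fun h => hn ?_
  have h2 : (0 : ℝ) < 2 ^ k := by positivity
  have h1 : (2 : ℝ) ^ k * (1 / 2) ^ k = 1 := by rw [← mul_pow]; norm_num
  obtain ⟨ha, hb⟩ := h
  have ha' := mul_le_mul_of_nonneg_left ha h2.le
  have hb' := mul_lt_mul_of_pos_left hb h2
  have e1 : (2 : ℝ) ^ k * (n * (1 / 2) ^ k) = n := by rw [mul_left_comm, h1, mul_one]
  rw [pow_succ] at hb'
  exact (Int.floor_eq_iff.2 ⟨by linarith, by linarith⟩).symm

theorem sub_dyadicAvg_floor (h : ℤ → ℝ) (k : ℕ) (u : ℝ) :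
    h ⌊2 ^ (k + 1) * u⌋ - dyadicAvg h ⌊2 ^ k * u⌋ = dyadicDiff h ⌊2 ^ k * u⌋ *
      haar ((⌊2 ^ k * u⌋ : ℤ) * (1 / 2) ^ k) ((1 / 2) ^ (k + 1)) u := by
  set v : ℝ := 2 ^ k * u with hv
  set n := ⌊v⌋ with hn
  have h2 : (0 : ℝ) < (1 / 2) ^ k := by positivity
  have hu : u = v * (1 / 2) ^ k := by
    have h1 : (2 : ℝ) ^ k * (1 / 2) ^ k = 1 := by rw [← mul_pow]; norm_num
    rw [hv, mul_right_comm, h1, one_mul]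
  have hv2 : 2 ^ (k + 1) * u = 2 * v := by rw [hv, pow_succ]; ring
  have hle : (n : ℝ) ≤ v := Int.floor_le v
  have hlt : v < n + 1 := Int.lt_floor_add_one v
  rw [hv2, haar, pow_succ]
  rcases lt_or_ge v (n + 1 / 2) with hc | hc
  · have hf : ⌊2 * v⌋ = 2 * n := by
      rw [Int.floor_eq_iff]
      push_cast
      constructor <;> linarith
    rw [hf, indicator_of_mem, indicator_of_notMem, dyadicAvg, dyadicDiff]
    · ring
    · rintro ⟨hx, -⟩
      rw [hu] at hx
      nlinarith
    · constructor <;> rw [hu] <;> nlinarith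
  · have hf : ⌊2 * v⌋ = 2 * n + 1 := by
      rw [Int.floor_eq_iff]
      push_cast
      constructor <;> linarith
    rw [hf, indicator_of_notMem, indicator_of_mem, dyadicAvg, dyadicDiff]
    · ring
    · constructor <;> rw [hu] <;> nlinarith
    · rintro ⟨-, hx⟩
      rw [hu] at hx
      nlinarith

/-- The Haar expansion of a dyadic step function. -/
theorem dyadic_telescope (u : ℝ) (F : ℕ → Finset ℤ) (K : ℕ) (h : ℤ → ℝ)
    (hF : ∀ k < K, ∀ n ∉ F k, dyadicDiff (dyadicAvg^[K - 1 - k] h) n = 0) :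
    h ⌊2 ^ K * u⌋ = dyadicAvg^[K] h ⌊u⌋ + ∑ k ∈ Finset.range K, ∑ n ∈ F k,
      dyadicDiff (dyadicAvg^[K - 1 - k] h) n * haar (n * (1 / 2) ^ k) ((1 / 2) ^ (k + 1)) u := by
  induction K generalizing h with
  | zero => simp
  | succ K ih =>
    have hit : ∀ k < K, dyadicAvg^[K - 1 - k] (dyadicAvg h) = dyadicAvg^[K + 1 - 1 - k] h := by
      intro k hk
      rw [← Function.iterate_succ_apply]
      congr 2
      omega
    have h1 := ih (dyadicAvg h) (fun k hk n hn => by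
      rw [hit k hk]
      exact hF k (by omega) n hn)
    have h2 : ∑ n ∈ F K, dyadicDiff h n * haar (n * (1 / 2) ^ K) ((1 / 2) ^ (K + 1)) u =
        h ⌊2 ^ (K + 1) * u⌋ - dyadicAvg h ⌊2 ^ K * u⌋ := by
      rw [sub_dyadicAvg_floor]
      refine Finset.sum_eq_single _ (fun n _ hn => ?_) (fun hn => ?_)
      · rw [haar_dyadic_eq_zero hn, mul_zero]
      · have := hF K (by omega) _ hn
        simp only [Nat.add_sub_cancel, tsub_self, Function.iterate_zero, id] at this
        rw [this, zero_mul]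
    rw [Finset.sum_range_succ, Function.iterate_succ_apply]
    simp only [Nat.add_sub_cancel, tsub_self, Function.iterate_zero, id]
    rw [h2]
    have h3 : ∑ k ∈ Finset.range K, ∑ n ∈ F k, dyadicDiff (dyadicAvg^[K - k] h) n *
          haar (n * (1 / 2) ^ k) ((1 / 2) ^ (k + 1)) u =
        ∑ k ∈ Finset.range K, ∑ n ∈ F k, dyadicDiff (dyadicAvg^[K - 1 - k] (dyadicAvg h)) n *
          haar (n * (1 / 2) ^ k) ((1 / 2) ^ (k + 1)) u := by
      refine Finset.sum_congr rfl fun k hk => ?_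
      rw [hit k (Finset.mem_range.1 hk), Nat.add_sub_cancel]
    rw [h3]
    linarith

/-- A nonnegative step function on the dyadic intervals of length `2⁻ᵏ` bounded by `B`, of total
mass at most `M`, and living (up to one interval) on `[3/4, 3]`. -/
structure IsDyadicProfile (k : ℕ) (B M : ℝ) (h : ℤ → ℝ) : Prop where
  nonneg : ∀ n, 0 ≤ h n
  le : ∀ n, h n ≤ B
  sum_le : ∀ F : Finset ℤ, ∑ n ∈ F, h n ≤ M
  support : ∀ n, h n ≠ 0 → 3 / 4 * 2 ^ k ≤ (n : ℝ) + 1 ∧ (n : ℝ) ≤ 3 * 2 ^ k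

theorem IsDyadicProfile.dyadicAvg {k : ℕ} {B M : ℝ} {h : ℤ → ℝ}
    (hh : IsDyadicProfile (k + 1) B M h) : IsDyadicProfile k B (M / 2) (dyadicAvg h) where
  nonneg n := by
    unfold _root_.dyadicAvg
    linarith [hh.nonneg (2 * n), hh.nonneg (2 * n + 1)]
  le n := by
    unfold _root_.dyadicAvg
    linarith [hh.le (2 * n), hh.le (2 * n + 1)]
  sum_le F := by
    have hi : Set.InjOn (fun n : ℤ => 2 * n) F := fun a _ b _ hab => by
      simp only at hab; omega
    have hi' : Set.InjOn (fun n : ℤ => 2 * n + 1) F := fun a _ b _ hab => by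
      simp only at hab; omega
    have hd : Disjoint (F.image fun n : ℤ => 2 * n) (F.image fun n : ℤ => 2 * n + 1) := by
      rw [Finset.disjoint_left]
      intro a ha hb
      obtain ⟨b, -, hb⟩ := Finset.mem_image.1 hb
      obtain ⟨c, -, hc⟩ := Finset.mem_image.1 ha
      omega
    have := hh.sum_le (F.image (fun n : ℤ => 2 * n) ∪ F.image fun n : ℤ => 2 * n + 1)
    rw [Finset.sum_union hd, Finset.sum_image hi, Finset.sum_image hi',
      ← Finset.sum_add_distrib] at this
    unfold _root_.dyadicAvg
    rw [← Finset.sum_div]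
    linarith
  support n hn := by
    have : h (2 * n) ≠ 0 ∨ h (2 * n + 1) ≠ 0 := by
      by_contra! hc
      exact hn (by simp [_root_.dyadicAvg, hc])
    rcases this with h1 | h1 <;> obtain ⟨h2, h3⟩ := hh.support _ h1 <;>
      rw [pow_succ] at h2 h3 <;> push_cast at h2 h3 <;> constructor <;> linarith

theorem IsDyadicProfile.iterate {k i : ℕ} {B M : ℝ} {h : ℤ → ℝ}
    (hh : IsDyadicProfile (k + i) B M h) :
    IsDyadicProfile k B (M / 2 ^ i) (_root_.dyadicAvg^[i] h) := by
  induction i generalizing M h with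
  | zero => simpa using hh
  | succ i ih =>
    rw [Function.iterate_succ_apply, pow_succ', ← div_div]
    exact ih hh.dyadicAvg

theorem abs_dyadicDiff_le {h : ℤ → ℝ} (hh : ∀ n, 0 ≤ h n) (n : ℤ) :
    |dyadicDiff h n| ≤ dyadicAvg h n := by
  unfold dyadicDiff dyadicAvg
  rw [abs_le]
  constructor <;> linarith [hh (2 * n), hh (2 * n + 1)]

theorem IsDyadicProfile.sum_sq_le {k : ℕ} {B M : ℝ} {h : ℤ → ℝ} (hh : IsDyadicProfile k B M h)
    (F : Finset ℤ) : ∑ n ∈ F, h n ^ 2 ≤ min B M * M := by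
  have hM : ∀ n, h n ≤ min B M := fun n => le_min (hh.le n) (by simpa using hh.sum_le {n})
  calc ∑ n ∈ F, h n ^ 2 ≤ ∑ n ∈ F, min B M * h n :=
        Finset.sum_le_sum fun n _ => by
          rw [sq]
          exact mul_le_mul_of_nonneg_right (hM n) (hh.nonneg n)
    _ = min B M * ∑ n ∈ F, h n := by rw [Finset.mul_sum]
    _ ≤ min B M * M := mul_le_mul_of_nonneg_left (hh.sum_le F) ((hh.nonneg 0).trans (hM 0))

/-- The number of `r ∈ R` whose dyadic index at scale `2⁻ᴷ` is within `10` of `n`. -/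
noncomputable def radialCount (K : ℕ) (R : Finset ℝ) (n : ℤ) : ℝ :=
  ∑ r ∈ R, if |⌊2 ^ K * r⌋ - n| ≤ 10 then 1 else 0

theorem isDyadicProfile_radialCount {δ : ℝ} (hδ : 0 < δ) (hδ1 : δ ≤ 1 / 80) {K : ℕ}
    (hK : (1 / 2) ^ K < 2 * δ) {R : Finset ℝ}
    (hR : ∀ r ∈ R, r ∈ Set.Icc (1 : ℝ) 2 ∧ ∃ k : ℤ, r = δ * k) :
    IsDyadicProfile K 43 (21 * R.card) (radialCount K R) where
  nonneg n := Finset.sum_nonneg fun r _ => by split_ifs <;> norm_num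
  le n := by
    have h2 : (0 : ℝ) < 2 ^ K := by positivity
    have h1 : (2 : ℝ) ^ K * (1 / 2) ^ K = 1 := by rw [← mul_pow]; norm_num
    have h3 : 1 < 2 * (δ * 2 ^ K) := by nlinarith
    set D := δ * 2 ^ K with hD
    have hD0 : 0 < D := by positivity
    set L : ℝ := ((n : ℝ) - 10) / D with hL
    have hsub : R.filter (fun r => |⌊2 ^ K * r⌋ - n| ≤ 10) ⊆
        (Finset.Icc ⌈L⌉ ⌊L + 42⌋).image (fun k : ℤ => δ * (k : ℝ)) := by
      intro r hr
      obtain ⟨hr, hrn⟩ := Finset.mem_filter.1 hr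
      obtain ⟨k, rfl⟩ := (hR r hr).2
      refine Finset.mem_image.2 ⟨k, Finset.mem_Icc.2 ⟨?_, ?_⟩, rfl⟩
      · rw [Int.ceil_le, hL, div_le_iff₀ hD0]
        have hf := Int.floor_le (2 ^ K * (δ * (k : ℝ)))
        have : n - 10 ≤ ⌊2 ^ K * (δ * (k : ℝ))⌋ := by have := abs_le.1 hrn; omega
        have : ((n - 10 : ℤ) : ℝ) ≤ (⌊2 ^ K * (δ * (k : ℝ))⌋ : ℤ) := by exact_mod_cast this
        push_cast at this
        linarith
      · rw [Int.le_floor, ← sub_le_iff_le_add, hL, le_div_iff₀ hD0]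
        have hf := Int.lt_floor_add_one (2 ^ K * (δ * (k : ℝ)))
        have : ⌊2 ^ K * (δ * (k : ℝ))⌋ ≤ n + 10 := by have := abs_le.1 hrn; omega
        have : ((⌊2 ^ K * (δ * (k : ℝ))⌋ : ℤ) : ℝ) ≤ ((n + 10 : ℤ) : ℝ) := by exact_mod_cast this
        push_cast at this
        linarith
    have hcard : (R.filter (fun r => |⌊2 ^ K * r⌋ - n| ≤ 10)).card ≤ 43 := by
      refine (Finset.card_le_card hsub).trans (Finset.card_image_le.trans ?_)
      rw [Int.card_Icc]
      have e1 := Int.le_ceil L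
      have e2 := Int.floor_le (L + 42)
      have : ((⌊L + 42⌋ : ℤ) : ℝ) ≤ ((⌈L⌉ + 42 : ℤ) : ℝ) := by push_cast; linarith
      have : ⌊L + 42⌋ ≤ ⌈L⌉ + 42 := by exact_mod_cast this
      omega
    unfold radialCount
    rw [Finset.sum_boole]
    exact_mod_cast hcard
  sum_le F := by
    unfold radialCount
    rw [Finset.sum_comm]
    calc _ ≤ ∑ r ∈ R, (21 : ℝ) := by
          refine Finset.sum_le_sum fun r _ => ?_
          rw [Finset.sum_boole]
          have hsub : F.filter (fun n => |⌊2 ^ K * r⌋ - n| ≤ 10) ⊆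
              Finset.Icc (⌊2 ^ K * r⌋ - 10) (⌊2 ^ K * r⌋ + 10) := by
            intro n hn
            have := abs_le.1 (Finset.mem_filter.1 hn).2
            rw [Finset.mem_Icc]
            omega
          have := Finset.card_le_card hsub
          rw [Int.card_Icc] at this
          have h21 : (F.filter (fun n => |⌊2 ^ K * r⌋ - n| ≤ 10)).card ≤ 21 := by omega
          exact_mod_cast h21
      _ = 21 * R.card := by rw [Finset.sum_const, nsmul_eq_mul, mul_comm]
  support n hn := by
    obtain ⟨r, hr, hrn⟩ := Finset.exists_ne_zero_of_sum_ne_zero hn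
    have h10 : |⌊2 ^ K * r⌋ - n| ≤ 10 := by
      by_contra hc
      exact hrn (if_neg hc)
    have h1 : (2 : ℝ) ^ K * (1 / 2) ^ K = 1 := by rw [← mul_pow]; norm_num
    have h2 : (0 : ℝ) < 2 ^ K := by positivity
    have h40 : (40 : ℝ) ≤ 2 ^ K := by nlinarith
    obtain ⟨hr1, hr2⟩ := (hR r hr).1
    have hf1 := Int.floor_le (2 ^ K * r)
    have hf2 := Int.lt_floor_add_one (2 ^ K * r)
    have ha : ⌊2 ^ K * r⌋ ≤ n + 10 := by have := abs_le.1 h10; omega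
    have hb : n - 10 ≤ ⌊2 ^ K * r⌋ := by have := abs_le.1 h10; omega
    have ha' : ((⌊2 ^ K * r⌋ : ℤ) : ℝ) ≤ ((n + 10 : ℤ) : ℝ) := by exact_mod_cast ha
    have hb' : ((n - 10 : ℤ) : ℝ) ≤ (⌊2 ^ K * r⌋ : ℤ) := by exact_mod_cast hb
    push_cast at ha' hb'
    constructor <;> nlinarith

theorem sum_indicator_annulus_le {δ : ℝ} {K : ℕ} (hK : δ ≤ (1 / 2) ^ K) (R : Finset ℝ)
    (x y : EuclideanSpace ℝ (Fin 2)) :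
    ∑ r ∈ R, (annulus (10 * δ) x r).indicator (fun _ => (1 : ℝ)) y ≤
      radialCount K R ⌊2 ^ K * dist y x⌋ := by
  refine Finset.sum_le_sum fun r _ => ?_
  by_cases hy : y ∈ annulus (10 * δ) x r
  · rw [indicator_of_mem hy, if_pos]
    have hy' : |dist y x - r| ≤ 10 * δ := hy
    obtain ⟨h1, h2⟩ := abs_le.1 hy'
    have h3 : (2 : ℝ) ^ K * (1 / 2) ^ K = 1 := by rw [← mul_pow]; norm_num
    have h4 : (0 : ℝ) < 2 ^ K := by positivity
    rw [abs_le]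
    constructor
    · have : ⌊2 ^ K * dist y x⌋ ≤ ⌊2 ^ K * r + (10 : ℤ)⌋ :=
        Int.floor_mono (by push_cast; nlinarith)
      rw [Int.floor_add_intCast] at this
      omega
    · have : ⌊2 ^ K * r⌋ ≤ ⌊2 ^ K * dist y x + (10 : ℤ)⌋ :=
        Int.floor_mono (by push_cast; nlinarith)
      rw [Int.floor_add_intCast] at this
      omega
  · rw [indicator_of_notMem hy]
    split_ifs <;> norm_num

theorem eLpNorm_two_le_ofReal {E : Type*} [MeasurableSpace E] {μ : Measure E} {f G : E → ℝ}
    (hf : ∀ y, f y ^ 2 ≤ G y) (hG : Integrable G μ) {B : ℝ} (hB : 0 ≤ B)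
    (h : ∫ y, G y ∂μ ≤ B ^ 2) : eLpNorm f 2 μ ≤ ENNReal.ofReal B := by
  have h1 : ∫⁻ y, ‖f y‖ₑ ^ (2 : ℝ) ∂μ ≤ ENNReal.ofReal B ^ (2 : ℝ) := by
    calc ∫⁻ y, ‖f y‖ₑ ^ (2 : ℝ) ∂μ ≤ ∫⁻ y, ENNReal.ofReal (G y) ∂μ := by
          refine lintegral_mono fun y => ?_
          rw [← ofReal_norm, ENNReal.rpow_two, ← ENNReal.ofReal_pow (norm_nonneg _),
            Real.norm_eq_abs, sq_abs]
          exact ENNReal.ofReal_le_ofReal (hf y)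
      _ = ENNReal.ofReal (∫ y, G y ∂μ) :=
          (ofReal_integral_eq_lintegral_ofReal hG
            (ae_of_all _ fun y => (sq_nonneg _).trans (hf y))).symm
      _ ≤ ENNReal.ofReal B ^ (2 : ℝ) := by
          rw [ENNReal.rpow_two, ← ENNReal.ofReal_pow hB]
          exact ENNReal.ofReal_le_ofReal h
  rw [eLpNorm_eq_lintegral_rpow_enorm_toReal (by norm_num) (by norm_num)]
  calc _ ≤ (ENNReal.ofReal B ^ (2 : ℝ)) ^ (1 / (2 : ℝ)) := by
        simp only [ENNReal.toReal_ofNat]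
        gcongr
    _ = ENNReal.ofReal B := by rw [← ENNReal.rpow_mul]; norm_num

theorem exists_pow_three_le_rpow_neg {ε : ℝ} (hε : 0 < ε) : ∃ A : ℝ, 0 < A ∧
    ∀ (K : ℕ) (δ : ℝ), 0 < δ → δ ≤ (1 / 2) ^ K → ((K : ℝ) + 1) ^ 3 ≤ A * δ ^ (-ε) := by
  have hr : 1 < (2 : ℝ) ^ ε := Real.one_lt_rpow (by norm_num) hε
  obtain ⟨B, hB⟩ := (tendsto_pow_const_div_const_pow_of_one_lt 3 hr).bddAbove_range
  have hB0 : 0 < B := by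
    have := hB (mem_range_self 1)
    simp only [Nat.cast_one, one_pow, pow_one] at this
    exact lt_of_lt_of_le (by positivity) this
  refine ⟨B * 2 ^ ε, by positivity, fun K δ hδ hK => ?_⟩
  have h1 := hB (mem_range_self (K + 1))
  simp only [Nat.cast_add, Nat.cast_one] at h1
  rw [div_le_iff₀ (by positivity), pow_succ _ K] at h1
  have h2 : ((2 : ℝ) ^ ε) ^ K ≤ δ ^ (-ε) := by
    have h3 := Real.rpow_le_rpow_of_nonpos hδ hK (neg_nonpos.2 hε.le)
    have h4 : ((1 / 2 : ℝ) ^ K) ^ (-ε) = ((2 : ℝ) ^ ε) ^ K := by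
      rw [Real.rpow_neg (by positivity), ← Real.inv_rpow (by positivity), one_div, inv_pow,
        inv_inv, ← Real.rpow_natCast, ← Real.rpow_natCast, ← Real.rpow_mul (by norm_num),
        ← Real.rpow_mul (by norm_num), mul_comm]
    rwa [h4] at h3
  calc _ ≤ _ := h1
    _ ≤ B * (δ ^ (-ε) * 2 ^ ε) := by gcongr
    _ = _ := by ring

theorem min_mul_self_le_rpow {α M t : ℝ} (hα1 : 1 ≤ α) (hα2 : α ≤ 2) (hM : 0 ≤ M)
    (ht : M ≤ 42 * t) : min 43 M * M ≤ 1849 * t ^ α := by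
  have ht0 : 0 ≤ t := by linarith
  rcases le_total t 1 with h | h
  · have h1 : t ^ (2 : ℝ) ≤ t ^ α :=
      Real.rpow_le_rpow_of_exponent_ge' ht0 h (by linarith) hα2
    rw [Real.rpow_two] at h1
    have h2 : min 43 M * M ≤ M * M := mul_le_mul_of_nonneg_right (min_le_right _ _) hM
    nlinarith
  · have h1 : t ≤ t ^ α := Real.self_le_rpow_of_one_le h hα1
    have h2 : min 43 M * M ≤ 43 * M := mul_le_mul_of_nonneg_right (min_le_left _ _) hM
    linarith

theorem sum_integral_sq_sum_haar_le {δ α C : ℝ} (hδ : 0 < δ) (hα : α ≤ 2) (hC : 0 ≤ C)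
    {X : Finset (EuclideanSpace ℝ (Fin 2))} (hX : IsKatzTao δ α C X)
    (hX1 : (X : Set (EuclideanSpace ℝ (Fin 2))) ⊆ closedBall 0 (1 / 4)) {k : ℕ}
    (hk : δ ≤ (1 / 2) ^ k) (F : Finset ℤ) {d : EuclideanSpace ℝ (Fin 2) → ℤ → ℝ} {D : ℝ}
    (hd : ∀ x ∈ X, ∀ n, d x n ≠ 0 → 3 / 4 * 2 ^ k ≤ (n : ℝ) + 1 ∧ (n : ℝ) ≤ 3 * 2 ^ k)
    (hD : ∀ x ∈ X, ∑ n ∈ F, d x n ^ 2 ≤ D) :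
    ∑ n ∈ F, ∫ y, (∑ x ∈ X, d x n * haar (n * (1 / 2) ^ k) ((1 / 2) ^ (k + 1)) (dist y x)) ^ 2 ≤
      8192 * (k + 1) * C * (1 / 2) ^ k * ((1 / 2) ^ k / δ) ^ α * (X.card * D) := by
  set S : ℝ := 8192 * (k + 1) * C * (1 / 2) ^ k * ((1 / 2) ^ k / δ) ^ α with hS
  have hS0 : 0 ≤ S := by positivity
  have h1 : ∀ n ∈ F, ∫ y, (∑ x ∈ X, d x n *
      haar (n * (1 / 2) ^ k) ((1 / 2) ^ (k + 1)) (dist y x)) ^ 2 ≤ S * ∑ x ∈ X, d x n ^ 2 := by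
    intro n _
    by_cases hn : 3 / 4 * 2 ^ k ≤ (n : ℝ) + 1 ∧ (n : ℝ) ≤ 3 * 2 ^ k
    · have e1 : (2 : ℝ) ^ k * (1 / 2) ^ k = 1 := by rw [← mul_pow]; norm_num
      have e2 : (0 : ℝ) < (1 / 2) ^ k := by positivity
      have e3 : (1 : ℝ) ≤ 2 ^ k := one_le_pow₀ (by norm_num)
      refine integral_sq_sum_haar_le (by positivity) X _ fun x hx =>
        sum_abs_integral_haar_mul_haar_le hδ hα hC hX hX1 hk ?_ ?_ hx
      · nlinarith
      · nlinarith
    · have h0 : ∀ x ∈ X, d x n = 0 := fun x hx => by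
        by_contra hc
        exact hn (hd x hx n hc)
      have hz : ∀ y : EuclideanSpace ℝ (Fin 2), (∑ x ∈ X, d x n *
          haar (n * (1 / 2) ^ k) ((1 / 2) ^ (k + 1)) (dist y x)) ^ 2 = 0 := fun y => by
        rw [Finset.sum_eq_zero fun x hx => by rw [h0 x hx, zero_mul], sq, zero_mul]
      simp only [hz, integral_zero]
      positivity
  calc _ ≤ ∑ n ∈ F, S * ∑ x ∈ X, d x n ^ 2 := Finset.sum_le_sum h1
    _ = S * ∑ x ∈ X, ∑ n ∈ F, d x n ^ 2 := by rw [← Finset.mul_sum, Finset.sum_comm]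
    _ ≤ S * ∑ x ∈ X, D := mul_le_mul_of_nonneg_left (Finset.sum_le_sum hD) hS0
    _ = _ := by rw [Finset.sum_const, nsmul_eq_mul]

theorem card_mul_le_two {δ : ℝ} (hδ : 0 < δ) (hδ1 : δ ≤ 1) {R : Finset ℝ}
    (hR : ∀ r ∈ R, r ∈ Set.Icc (1 : ℝ) 2 ∧ ∃ k : ℤ, r = δ * k) : R.card * δ ≤ 2 := by
  have hsub : R ⊆ (Finset.Icc ⌈1 / δ⌉ ⌊2 / δ⌋).image (fun k : ℤ => δ * (k : ℝ)) := by
    intro r hr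
    obtain ⟨⟨h1, h2⟩, k, rfl⟩ := hR r hr
    refine Finset.mem_image.2 ⟨k, Finset.mem_Icc.2 ⟨?_, ?_⟩, rfl⟩
    · rw [Int.ceil_le, div_le_iff₀ hδ]
      linarith
    · rw [Int.le_floor, le_div_iff₀ hδ]
      linarith
  have hcard := (Finset.card_le_card hsub).trans Finset.card_image_le
  rw [Int.card_Icc] at hcard
  have h1 := Int.le_ceil (1 / δ)
  have h2 := Int.floor_le (2 / δ)
  have h3 : (R.card : ℝ) ≤ 1 / δ + 1 := by
    rcases le_or_gt 0 (⌊2 / δ⌋ + 1 - ⌈1 / δ⌉) with h | h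
    · have : (R.card : ℤ) ≤ ⌊2 / δ⌋ + 1 - ⌈1 / δ⌉ := by omega
      have : (R.card : ℝ) ≤ ((⌊2 / δ⌋ + 1 - ⌈1 / δ⌉ : ℤ) : ℝ) := by exact_mod_cast this
      push_cast at this
      have e : 2 / δ = 1 / δ + 1 / δ := by ring
      linarith
    · have : R.card = 0 := by omega
      rw [this, Nat.cast_zero]
      positivity
  calc R.card * δ ≤ (1 / δ + 1) * δ := by gcongr
    _ = 1 + δ := by field_simp
    _ ≤ 2 := by linarith

theorem IsKatzTao.card_le {δ α C : ℝ} {X : Finset (EuclideanSpace ℝ (Fin 2))}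
    (hX : IsKatzTao δ α C X) (hδ : δ ≤ 1)
    (hX1 : (X : Set (EuclideanSpace ℝ (Fin 2))) ⊆ closedBall 0 (1 / 4)) :
    (X.card : ℝ) ≤ C * (1 / δ) ^ α := by
  refine le_trans (le_of_eq ?_) (hX 0 1 hδ le_rfl)
  rw [inter_eq_left.2 (hX1.trans (closedBall_subset_closedBall (by norm_num))),
    Set.ncard_coe_finset]

theorem rpow_le_four_mul_rpow {η α β : ℝ} (hη : 0 ≤ η) (hη2 : η ≤ 2) (hβ : 0 ≤ β) (hβα : β ≤ α)
    (hα : α ≤ 2) : η ^ α ≤ 4 * η ^ β := by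
  have h1 : (η / 2) ^ α ≤ (η / 2) ^ β :=
    Real.rpow_le_rpow_of_exponent_ge' (by positivity) (by linarith) hβ hβα
  have h2 : (2 : ℝ) ^ α ≤ 4 := by
    calc (2 : ℝ) ^ α ≤ 2 ^ (2 : ℝ) := Real.rpow_le_rpow_of_exponent_le (by norm_num) hα
      _ = 4 := by norm_num
  calc η ^ α = 2 ^ α * (η / 2) ^ α := by
        rw [← Real.mul_rpow (by norm_num) (by positivity)]
        congr 1
        ring
    _ ≤ 4 * η ^ β := by
        gcongr
        exact h1.trans (Real.rpow_le_rpow (by positivity) (by linarith) hβ)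

theorem integral_indicator_closedBall_const {r : ℝ} (hr : 0 ≤ r) (c : ℝ) :
    ∫ y, (closedBall (0 : EuclideanSpace ℝ (Fin 2)) r).indicator (fun _ => c) y =
      r ^ 2 * Real.pi * c := by
  rw [integral_indicator isClosed_closedBall.measurableSet, setIntegral_const,
    measureReal_def, EuclideanSpace.volume_closedBall_fin_two, ENNReal.toReal_mul,
    ENNReal.toReal_pow, ENNReal.toReal_ofReal hr, smul_eq_mul]
  simp [Real.pi_nonneg]

theorem integrable_indicator_closedBall_const (r c : ℝ) :
    Integrable ((closedBall (0 : EuclideanSpace ℝ (Fin 2)) r).indicator fun _ => c) :=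
  (integrable_indicator_iff isClosed_closedBall.measurableSet).2
    (integrableOn_const measure_closedBall_lt_top.ne)

theorem annSum_nonneg (δ : ℝ) (X : Finset (EuclideanSpace ℝ (Fin 2)))
    (R : EuclideanSpace ℝ (Fin 2) → Finset ℝ) (y : EuclideanSpace ℝ (Fin 2)) :
    0 ≤ annSum δ X R y :=
  Finset.sum_nonneg fun _ _ => Finset.sum_nonneg fun _ _ =>
    indicator_nonneg (fun _ _ => zero_le_one) _

theorem exists_majorant_of_large {δ α C : ℝ} {m : ℕ} (hδ : 1 / 80 ≤ δ) (hδ1 : δ < 1)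
    (hα1 : 1 ≤ α) (hα2 : α ≤ 2) (hC : 1 ≤ C) (hm : 1 ≤ m)
    {X : Finset (EuclideanSpace ℝ (Fin 2))} (hX : IsKatzTao δ α C X)
    (hX1 : (X : Set (EuclideanSpace ℝ (Fin 2))) ⊆ closedBall 0 (1 / 4))
    {R : EuclideanSpace ℝ (Fin 2) → Finset ℝ}
    (hR : ∀ x ∈ X, (R x).card = m ∧ ∀ r ∈ R x, r ∈ Set.Icc (1 : ℝ) 2 ∧ ∃ k : ℤ, r = δ * k) :
    ∃ G : EuclideanSpace ℝ (Fin 2) → ℝ, Integrable G ∧ (∀ y, annSum δ X R y ^ 2 ≤ G y) ∧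
      ∫ y, G y ≤ 10 ^ 9 * C * (m : ℝ) ^ α * X.card := by
  have hδ0 : 0 < δ := by linarith
  have hm0 : (1 : ℝ) ≤ m := by exact_mod_cast hm
  refine ⟨_, integrable_indicator_closedBall_const 13 ((X.card * m) ^ 2), fun y => ?_, ?_⟩
  · by_cases hy : y ∈ closedBall (0 : EuclideanSpace ℝ (Fin 2)) 13
    · rw [indicator_of_mem hy]
      refine pow_le_pow_left₀ (annSum_nonneg _ _ _ _) ?_ 2
      calc annSum δ X R y ≤ ∑ x ∈ X, ∑ r ∈ R x, (1 : ℝ) :=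
            Finset.sum_le_sum fun x _ => Finset.sum_le_sum fun r _ =>
              indicator_le_self' (fun _ _ => zero_le_one) _
        _ = ∑ x ∈ X, (m : ℝ) := Finset.sum_congr rfl fun x hx => by simp [(hR x hx).1]
        _ = X.card * m := by rw [Finset.sum_const, nsmul_eq_mul]
    · rw [indicator_of_notMem hy]
      have : annSum δ X R y = 0 := by
        refine Finset.sum_eq_zero fun x hx => Finset.sum_eq_zero fun r hr =>
          indicator_of_notMem (fun h => hy ?_) _
        have h1 : |dist y x - r| ≤ 10 * δ := h
        have h2 := hX1 hx
        have h3 := ((hR x hx).2 r hr).1.2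
        rw [mem_closedBall] at h2 ⊢
        linarith [(abs_le.1 h1).2, dist_triangle y x 0]
      rw [this, sq, zero_mul]
  · rw [integral_indicator_closedBall_const (by norm_num)]
    rcases X.eq_empty_or_nonempty with rfl | ⟨x, hx⟩
    · simp
    have h1 : (X.card : ℝ) ≤ C * 6400 := by
      refine (hX.card_le hδ1.le hX1).trans ?_
      have h80 : 1 / δ ≤ 80 := by
        rw [div_le_iff₀ hδ0]
        linarith
      have h3 : 1 ≤ 1 / δ := by
        rw [le_div_iff₀ hδ0]
        linarith
      have : (1 / δ) ^ α ≤ 6400 := by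
        calc (1 / δ) ^ α ≤ (1 / δ) ^ (2 : ℝ) := Real.rpow_le_rpow_of_exponent_le h3 hα2
          _ = (1 / δ) ^ 2 := Real.rpow_two _
          _ ≤ 80 ^ 2 := by gcongr
          _ = 6400 := by norm_num
      gcongr
    have h2 : (m : ℝ) ≤ 160 := by
      have := card_mul_le_two hδ0 hδ1.le (hR x hx).2
      rw [(hR x hx).1] at this
      nlinarith
    have h4 : (m : ℝ) ≤ (m : ℝ) ^ α := Real.self_le_rpow_of_one_le hm0 hα1
    have hpi : Real.pi ≤ 4 := Real.pi_le_four
    calc 13 ^ 2 * Real.pi * (X.card * m) ^ 2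
        = 13 ^ 2 * Real.pi * X.card * m * m * X.card := by ring
      _ ≤ 13 ^ 2 * 4 * (C * 6400) * 160 * (m : ℝ) ^ α * X.card := by gcongr
      _ ≤ _ := by
        have : 0 ≤ C * (m : ℝ) ^ α * X.card := by positivity
        nlinarith

theorem exists_majorant_of_small {δ α C : ℝ} {m K : ℕ} (hδ : 0 < δ) (hδ1 : δ ≤ 1 / 80)
    (hK : δ ≤ (1 / 2) ^ K) (hK2 : (1 / 2) ^ K < 2 * δ)
    (hα1 : 1 ≤ α) (hα2 : α ≤ 2) (hC : 1 ≤ C)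
    {X : Finset (EuclideanSpace ℝ (Fin 2))} (hX : IsKatzTao δ α C X)
    (hX1 : (X : Set (EuclideanSpace ℝ (Fin 2))) ⊆ closedBall 0 (1 / 4))
    {R : EuclideanSpace ℝ (Fin 2) → Finset ℝ}
    (hR : ∀ x ∈ X, (R x).card = m ∧ ∀ r ∈ R x, r ∈ Set.Icc (1 : ℝ) 2 ∧ ∃ k : ℤ, r = δ * k) :
    ∃ G : EuclideanSpace ℝ (Fin 2) → ℝ, Integrable G ∧ (∀ y, annSum δ X R y ^ 2 ≤ G y) ∧
      ∫ y, G y ≤ 10 ^ 9 * C * ((K : ℝ) + 1) ^ 3 * (m : ℝ) ^ α * X.card := by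
  set h : EuclideanSpace ℝ (Fin 2) → ℤ → ℝ := fun x => radialCount K (R x) with hh
  have hprof : ∀ x ∈ X, IsDyadicProfile K 43 (21 * m) (h x) := fun x hx => by
    have := isDyadicProfile_radialCount hδ hδ1 hK2 (hR x hx).2
    rwa [(hR x hx).1] at this
  have hlevel : ∀ x ∈ X, ∀ k ≤ K,
      IsDyadicProfile k 43 (21 * m / 2 ^ (K - k)) (dyadicAvg^[K - k] (h x)) := by
    intro x hx k hk
    refine IsDyadicProfile.iterate ?_
    rw [Nat.add_sub_cancel' hk]
    exact hprof x hx
  have hmass : ∀ k ≤ K, (21 : ℝ) * m / 2 ^ (K - k) ≤ 42 * (m * δ * 2 ^ k) := by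
    intro k hk
    have e : (2 : ℝ) ^ K = 2 ^ (K - k) * 2 ^ k := by rw [← pow_add, Nat.sub_add_cancel hk]
    have e1 : (2 : ℝ) ^ K * (1 / 2) ^ K = 1 := by rw [← mul_pow]; norm_num
    have e2 : (1 : ℝ) ≤ 2 * δ * (2 ^ (K - k) * 2 ^ k) := by
      rw [← e, ← e1, mul_comm]
      gcongr
    rw [div_le_iff₀ (by positivity)]
    have := mul_le_mul_of_nonneg_left e2 (by positivity : (0 : ℝ) ≤ 21 * m)
    linarith
  set d : ℕ → EuclideanSpace ℝ (Fin 2) → ℤ → ℝ :=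
    fun k x => dyadicDiff (dyadicAvg^[K - 1 - k] (h x)) with hd
  have hdle : ∀ k < K, ∀ x ∈ X, ∀ n, |d k x n| ≤ dyadicAvg^[K - k] (h x) n := by
    intro k hk x hx n
    have e : K - k = K - 1 - k + 1 := by omega
    rw [e, Function.iterate_succ_apply']
    refine abs_dyadicDiff_le (fun n' => ?_) n
    have := (hlevel x hx (k + 1) hk).nonneg n'
    rwa [show K - (k + 1) = K - 1 - k by omega] at this
  have hdsupp : ∀ k < K, ∀ x ∈ X, ∀ n, d k x n ≠ 0 →
      3 / 4 * 2 ^ k ≤ (n : ℝ) + 1 ∧ (n : ℝ) ≤ 3 * 2 ^ k := by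
    intro k hk x hx n hn
    refine (hlevel x hx k hk.le).support n fun h0 => hn ?_
    have := hdle k hk x hx n
    rwa [h0, abs_nonpos_iff] at this
  set F : ℕ → Finset ℤ := fun k => Finset.Icc 0 (3 * 2 ^ k) with hF
  have hFcard : ∀ k, ((F k).card : ℝ) ≤ 4 * 2 ^ k := by
    intro k
    have : (F k).card = 3 * 2 ^ k + 1 := by
      rw [hF, Int.card_Icc]
      have : (3 * 2 ^ k + 1 - 0 : ℤ) = ((3 * 2 ^ k + 1 : ℕ) : ℤ) := by push_cast; ring
      rw [this, Int.toNat_natCast]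
    rw [this]
    push_cast
    linarith [one_le_pow₀ (by norm_num : (1 : ℝ) ≤ 2) (n := k)]
  have hFsupp : ∀ k < K, ∀ x ∈ X, ∀ n ∉ F k, d k x n = 0 := by
    intro k hk x hx n hn
    by_contra hc
    obtain ⟨h1, h2⟩ := hdsupp k hk x hx n hc
    refine hn (Finset.mem_Icc.2 ⟨?_, ?_⟩)
    · have : (0 : ℝ) < ((n + 1 : ℤ) : ℝ) := by
        push_cast
        exact lt_of_lt_of_le (by positivity) h1
      have : 0 < n + 1 := by exact_mod_cast this
      omega
    · exact_mod_cast h2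
  set g : ℕ → ℤ → EuclideanSpace ℝ (Fin 2) → ℝ := fun k n y =>
    ∑ x ∈ X, d k x n * haar (n * (1 / 2) ^ k) ((1 / 2) ^ (k + 1)) (dist y x) with hg
  set T : ℝ := X.card * (42 * (m * δ)) with hT
  set Q : ℝ := C * (m : ℝ) ^ α * X.card with hQ
  have hpow : (m * δ) ^ α * (1 / δ) ^ α = (m : ℝ) ^ α := by
    rw [← Real.mul_rpow (by positivity) (by positivity)]
    congr 1
    field_simp
  have hgint : ∀ k < K, ∑ n ∈ F k, ∫ y, g k n y ^ 2 ≤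
      8192 * (k + 1) * C * (1 / 2) ^ k * ((1 / 2) ^ k / δ) ^ α *
        (X.card * (1849 * (m * δ * 2 ^ k) ^ α)) := by
    intro k hk
    refine sum_integral_sq_sum_haar_le hδ hα2 (by linarith) hX hX1
      (hK.trans (pow_le_pow_of_le_one (by norm_num) (by norm_num) hk.le)) (F k)
      (hdsupp k hk) fun x hx => ?_
    have hl := hlevel x hx k hk.le
    calc ∑ n ∈ F k, d k x n ^ 2 ≤ ∑ n ∈ F k, dyadicAvg^[K - k] (h x) n ^ 2 :=
          Finset.sum_le_sum fun n _ => by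
            rw [← sq_abs (d k x n)]
            exact pow_le_pow_left₀ (abs_nonneg _) (hdle k hk x hx n) 2
      _ ≤ _ := hl.sum_sq_le _
      _ ≤ _ := min_mul_self_le_rpow hα1 hα2 (by positivity) (hmass k hk.le)
  have hscale : ∀ k < K, ((F k).card : ℝ) * ∑ n ∈ F k, ∫ y, g k n y ^ 2 ≤
      60588032 * (K + 1) * Q := by
    intro k hk
    have hkK : (k : ℝ) ≤ K := by exact_mod_cast hk.le
    have e1 : (2 : ℝ) ^ k * (1 / 2) ^ k = 1 := by rw [← mul_pow]; norm_num
    have e2 : ((1 / 2 : ℝ) ^ k / δ) ^ α * (m * δ * 2 ^ k) ^ α = (m : ℝ) ^ α := by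
      rw [← Real.mul_rpow (by positivity) (by positivity)]
      congr 1
      calc (1 / 2 : ℝ) ^ k / δ * (m * δ * 2 ^ k) = m * (δ / δ) * (2 ^ k * (1 / 2) ^ k) := by ring
        _ = m := by rw [e1, div_self hδ.ne', mul_one, mul_one]
    calc _ ≤ 4 * 2 ^ k * (8192 * (k + 1) * C * (1 / 2) ^ k * ((1 / 2) ^ k / δ) ^ α *
        (X.card * (1849 * (m * δ * 2 ^ k) ^ α))) :=
          mul_le_mul (hFcard k) (hgint k hk)
            (Finset.sum_nonneg fun n _ => integral_nonneg fun y => sq_nonneg _) (by positivity)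
      _ = 60588032 * (k + 1) * C * (2 ^ k * (1 / 2) ^ k) *
          (((1 / 2) ^ k / δ) ^ α * (m * δ * 2 ^ k) ^ α) * X.card := by ring
      _ = 60588032 * (k + 1) * Q := by rw [e1, e2, hQ]; ring
      _ ≤ _ := by gcongr
  have hgi : ∀ k n, Integrable fun y => g k n y ^ 2 := fun k n =>
    integrable_sq_sum_haar (by positivity) X _
  have hsi : Integrable fun y => ∑ k ∈ Finset.range K,
      ((F k).card : ℝ) * ∑ n ∈ F k, g k n y ^ 2 :=
    integrable_finsetSum _ fun k _ => (integrable_finsetSum _ fun n _ => hgi k n).const_mul _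
  have hti := integrable_indicator_closedBall_const 5 (T ^ 2)
  have hTQ : T ^ 2 ≤ 7056 * Q := by
    rcases X.eq_empty_or_nonempty with rfl | ⟨x, hx⟩
    · simp [hT, hQ]
    have h1 := hX.card_le (by linarith) hX1
    have h2 : m * δ ≤ 2 := by
      have := card_mul_le_two hδ (by linarith) (hR x hx).2
      rwa [(hR x hx).1] at this
    have h3 : (m * δ) ^ 2 ≤ 4 * (m * δ) ^ α := by
      rw [← Real.rpow_two]
      exact rpow_le_four_mul_rpow (by positivity) h2 (by linarith) hα2 le_rfl
    calc T ^ 2 = 1764 * X.card * X.card * (m * δ) ^ 2 := by rw [hT]; ring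
      _ ≤ 1764 * X.card * (C * (1 / δ) ^ α) * (4 * (m * δ) ^ α) := by gcongr
      _ = 7056 * C * ((m * δ) ^ α * (1 / δ) ^ α) * X.card := by ring
      _ = 7056 * Q := by rw [hpow, hQ]; ring
  refine ⟨fun y => 2 * (closedBall (0 : EuclideanSpace ℝ (Fin 2)) 5).indicator (fun _ => T ^ 2) y +
    2 * (K * ∑ k ∈ Finset.range K, ((F k).card : ℝ) * ∑ n ∈ F k, g k n y ^ 2),
    (hti.const_mul _).add ((hsi.const_mul _).const_mul _), fun y => ?_, ?_⟩
  · have hle : annSum δ X R y ≤ (∑ x ∈ X, dyadicAvg^[K] (h x) ⌊dist y x⌋) +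
        ∑ k ∈ Finset.range K, ∑ n ∈ F k, g k n y := by
      calc annSum δ X R y ≤ ∑ x ∈ X, h x ⌊2 ^ K * dist y x⌋ :=
            Finset.sum_le_sum fun x _ => sum_indicator_annulus_le hK (R x) x y
        _ = ∑ x ∈ X, (dyadicAvg^[K] (h x) ⌊dist y x⌋ + ∑ k ∈ Finset.range K, ∑ n ∈ F k,
            d k x n * haar (n * (1 / 2) ^ k) ((1 / 2) ^ (k + 1)) (dist y x)) :=
            Finset.sum_congr rfl fun x hx => dyadic_telescope _ F K (h x) fun k hk n hn =>
              hFsupp k hk x hx n hn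
        _ = _ := by
            rw [Finset.sum_add_distrib, Finset.sum_comm]
            congr 1
            exact Finset.sum_congr rfl fun k _ => Finset.sum_comm
    have htop : (∑ x ∈ X, dyadicAvg^[K] (h x) ⌊dist y x⌋) ^ 2 ≤
        (closedBall (0 : EuclideanSpace ℝ (Fin 2)) 5).indicator (fun _ => T ^ 2) y := by
      by_cases hy : y ∈ closedBall (0 : EuclideanSpace ℝ (Fin 2)) 5
      · rw [indicator_of_mem hy]
        refine pow_le_pow_left₀ (Finset.sum_nonneg fun x hx =>
          (hlevel x hx 0 (Nat.zero_le _)).nonneg _) ?_ 2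
        rw [hT, ← nsmul_eq_mul]
        refine Finset.sum_le_card_nsmul _ _ _ fun x hx => ?_
        have h1 := (hlevel x hx 0 (Nat.zero_le _)).sum_le {⌊dist y x⌋}
        have h2 := hmass 0 (Nat.zero_le _)
        rw [Finset.sum_singleton, Nat.sub_zero] at h1
        rw [Nat.sub_zero, pow_zero, mul_one] at h2
        exact h1.trans h2
      · rw [indicator_of_notMem hy, Finset.sum_eq_zero, sq, zero_mul]
        intro x hx
        by_contra hc
        have h1 := ((hlevel x hx 0 (Nat.zero_le _)).support _ hc).2
        have h2 := Int.lt_floor_add_one (dist y x)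
        have h3 := hX1 hx
        rw [mem_closedBall] at h3 hy
        linarith [dist_triangle y x 0]
    have hsum : (∑ k ∈ Finset.range K, ∑ n ∈ F k, g k n y) ^ 2 ≤
        K * ∑ k ∈ Finset.range K, ((F k).card : ℝ) * ∑ n ∈ F k, g k n y ^ 2 := by
      refine sq_sum_le_card_mul_sum_sq.trans ?_
      rw [Finset.card_range]
      gcongr
      exact sq_sum_le_card_mul_sum_sq
    have h0 := pow_le_pow_left₀ (annSum_nonneg δ X R y) hle 2
    refine h0.trans (add_sq_le.trans ?_)
    rw [mul_add]
    exact add_le_add (mul_le_mul_of_nonneg_left htop zero_le_two)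
      (mul_le_mul_of_nonneg_left hsum zero_le_two)
  · have hgs : ∫ y, ∑ k ∈ Finset.range K, ((F k).card : ℝ) * ∑ n ∈ F k, g k n y ^ 2 ≤
        K * (60588032 * (K + 1) * Q) := by
      rw [integral_finsetSum _ fun k _ =>
        (integrable_finsetSum _ fun n _ => hgi k n).const_mul _]
      calc _ ≤ ∑ k ∈ Finset.range K, 60588032 * (K + 1) * Q := by
            refine Finset.sum_le_sum fun k hk => ?_
            rw [integral_const_mul, integral_finsetSum _ fun n _ => hgi k n]
            exact hscale k (Finset.mem_range.1 hk)
        _ = _ := by rw [Finset.sum_const, Finset.card_range, nsmul_eq_mul]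
    rw [integral_add (hti.const_mul _) ((hsi.const_mul _).const_mul _), integral_const_mul,
      integral_const_mul, integral_const_mul, integral_indicator_closedBall_const (by norm_num)]
    have hQ0 : 0 ≤ Q := by positivity
    have hK0 : (0 : ℝ) ≤ K := Nat.cast_nonneg K
    calc _ ≤ 2 * (5 ^ 2 * 4 * (7056 * Q)) + 2 * (K * (K * (60588032 * (K + 1) * Q))) := by
          gcongr
          exact Real.pi_le_four
      _ ≤ 2 * (5 ^ 2 * 4 * (7056 * Q)) * (K + 1) ^ 3 +
          2 * ((K + 1) * ((K + 1) * (60588032 * (K + 1) * Q))) := by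
          refine add_le_add
            (le_mul_of_one_le_right (by positivity) (one_le_pow₀ (by linarith))) ?_
          gcongr <;> linarith
      _ = 122587264 * (Q * (K + 1) ^ 3) := by ring
      _ ≤ 10 ^ 9 * (Q * (K + 1) ^ 3) := by
          gcongr
          norm_num
      _ = _ := by rw [hQ]; ring

/-- Case (2) of the discretized dual estimate: for `α ∈ (1,2]` and `s(2-α) ≤ 2`, the
`L²` norm of the sum of indicators of annuli is `≲ δ^{-ε} (mδ)^{1/s´} δ^{-α/2} (#X)^{1/2}`,
where `1/s' = 1 - 1/s` is the conjugate exponent of `s`. -/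
theorem stmt12 (α s : ℝ) (hα0 : 1 < α) (hα1 : α ≤ 2) (hs1 : 1 ≤ s)
    (hsα : s * (2 - α) ≤ 2) (C₀ : ℝ) (hC₀ : 1 ≤ C₀) :
    ∀ ε : ℝ, 0 < ε → ∃ A : ℝ, 0 < A ∧
      ∀ δ : ℝ, 0 < δ → δ < 1 →
      ∀ X : Finset (EuclideanSpace ℝ (Fin 2)), InLattice δ X →
        (X : Set (EuclideanSpace ℝ (Fin 2))) ⊆
          Metric.closedBall (0 : EuclideanSpace ℝ (Fin 2)) (1/4) →
        IsKatzTao δ α C₀ X →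
      ∀ m : ℕ, 1 ≤ m →
      ∀ R : EuclideanSpace ℝ (Fin 2) → Finset ℝ,
        (∀ x ∈ X, (R x).card = m ∧
          ∀ r ∈ R x, r ∈ Set.Icc (1 : ℝ) 2 ∧ ∃ k : ℤ, r = δ * k) →
        eLpNorm (annSum δ X R) (2 : ENNReal) volume
          ≤ ENNReal.ofReal (A * δ ^ (-ε) * (m * δ) ^ (1 - 1 / s) * δ ^ (-(α / 2)) *
              (X.card : ℝ) ^ ((1 : ℝ) / 2)) := by
  intro ε hε
  obtain ⟨A, hA, hlog⟩ := exists_pow_three_le_rpow_neg (mul_pos two_pos hε)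
  refine ⟨Real.sqrt (4 * 10 ^ 9 * C₀ * A), by positivity, ?_⟩
  intro δ hδ hδ1 X _ hX1 hX m hm R hR
  rcases X.eq_empty_or_nonempty with rfl | ⟨x, hx⟩
  · have : annSum δ ∅ R = 0 := funext fun y => by simp [annSum]
    simp [this]
  obtain ⟨K, hK, hK'⟩ := exists_nat_pow_near_of_lt_one hδ hδ1.le
    (by norm_num : (0 : ℝ) < 1 / 2) (by norm_num)
  have hmaj : ∃ G : EuclideanSpace ℝ (Fin 2) → ℝ, Integrable G ∧
      (∀ y, annSum δ X R y ^ 2 ≤ G y) ∧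
      ∫ y, G y ≤ 10 ^ 9 * C₀ * ((K : ℝ) + 1) ^ 3 * (m : ℝ) ^ α * X.card := by
    rcases le_total δ (1 / 80) with h | h
    · rw [pow_succ] at hK
      exact exists_majorant_of_small hδ h hK' (by linarith) hα0.le hα1 hC₀ hX hX1 hR
    · obtain ⟨G, hG, hle, hint⟩ := exists_majorant_of_large h hδ1 hα0.le hα1 hC₀ hm hX hX1 hR
      have hK1 : 1 ≤ ((K : ℝ) + 1) ^ 3 := one_le_pow₀ (by
        linarith [(Nat.cast_nonneg K : (0 : ℝ) ≤ K)])
      refine ⟨G, hG, hle, hint.trans ?_⟩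
      calc 10 ^ 9 * C₀ * (m : ℝ) ^ α * X.card = 10 ^ 9 * C₀ * 1 * (m : ℝ) ^ α * X.card := by
            rw [mul_one]
        _ ≤ _ := by gcongr
  obtain ⟨G, hG, hle, hint⟩ := hmaj
  refine eLpNorm_two_le_ofReal hle hG (by positivity) (hint.trans ?_)
  have hη : m * δ ≤ 2 := by
    have := card_mul_le_two hδ hδ1.le (hR x hx).2
    rwa [(hR x hx).1] at this
  have hs0 : 0 < s := by linarith
  have hβ : 0 ≤ 1 - 1 / s := by
    rw [sub_nonneg, div_le_one hs0]
    exact hs1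
  have hβα : 2 * (1 - 1 / s) ≤ α := by
    have : 2 - α ≤ 2 / s := by
      rw [le_div_iff₀ hs0]
      linarith
    have e : 2 * (1 / s) = 2 / s := by ring
    linarith
  have sq_rpow : ∀ {a b : ℝ}, 0 ≤ a → (a ^ b) ^ 2 = a ^ (2 * b) := fun {a b} ha => by
    rw [← Real.rpow_natCast, ← Real.rpow_mul ha, mul_comm]
    norm_num
  have hmα : (m : ℝ) ^ α = (m * δ) ^ α * δ ^ (2 * -(α / 2)) := by
    rw [Real.mul_rpow (by positivity) hδ.le, mul_assoc, ← Real.rpow_add hδ]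
    ring_nf
    simp
  rw [mul_pow, mul_pow, mul_pow, mul_pow, sq_rpow hδ.le, sq_rpow (by positivity),
    sq_rpow hδ.le, sq_rpow (by positivity), Real.sq_sqrt (by positivity), hmα]
  calc _ ≤ 10 ^ 9 * C₀ * (A * δ ^ (-(2 * ε))) *
        ((4 * (m * δ) ^ (2 * (1 - 1 / s))) * δ ^ (2 * -(α / 2))) * X.card := by
        gcongr
        · exact hlog K δ hδ hK'
        · exact rpow_le_four_mul_rpow (by positivity) hη (by positivity) hβα hα1
    _ = _ := by
        rw [show (2 : ℝ) * (1 / 2) = 1 by norm_num, Real.rpow_one, mul_neg, mul_neg]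
        ring
end

section
/- Let α ∈ (1,2], C₀ ≥ 1 and ε > 0. There exist constants c > 0, C' > 0 and δ₀ ∈ (0,1) such that for every δ ∈ (0,δ₀), every Katz–Tao (δ,α,C₀)-set X ⊆ δℤ² ∩ [0,1]², and every i ∈ {0,1,…,99}, there exist an angle θ ∈ [2πi/100, 2π(i+1)/100] and a subset X' ⊆ X with #X' ≥ c·δ^ε·#X such that for every a ∈ ℝ, the slice {x ∈ X' : ⟨x, (cos θ, sin θ)⟩ ∈ [a, a+δ]} is a Katz–Tao (δ, α−1, C')-set. -/
open MeasureTheory Metric Set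

/-- `Y ⊆ ℝ²` is a Katz–Tao `(δ,β,C)`-set:
`#(Y ∩ B(x,r)) ≤ C·(r/δ)^β` for all `x` and all `r ∈ [δ,1]`. -/
def IsKatzTaoSet (δ β C : ℝ) (Y : Set (EuclideanSpace ℝ (Fin 2))) : Prop :=
  ∀ (x : EuclideanSpace ℝ (Fin 2)) (r : ℝ), δ ≤ r → r ≤ 1 →
    ((Y ∩ Metric.closedBall x r).ncard : ℝ) ≤ C * (r / δ) ^ β

/-- Every finite set with an injective linearly ordered key has a subset of proportion `1 / n` that
is sparse: between its extreme points, any nonempty part of it leaves many original points. -/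
theorem exists_sparse_subset {ι L : Type*} [LinearOrder L] (S : Finset ι) (key : ι → L)
    (hkey : Set.InjOn key S) (n : ℕ) (hn : 0 < n) :
    ∃ S' ⊆ S, S.card ≤ n * S'.card ∧ ∀ P ⊆ S', P.Nonempty → ∃ p ∈ P, ∃ q ∈ P,
      n * P.card ≤ (S.filter fun y => key p ≤ key y ∧ key y < key q).card + n := by
  classical
  set rank : ι → ℕ := fun x => (S.filter fun y => key y < key x).card with hrank
  obtain ⟨t, -, ht⟩ : ∃ t ∈ Finset.range n,
      S.card ≤ n * (S.filter fun x => rank x % n = t).card := by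
    by_contra! hcon
    have hsum : S.card = ∑ t ∈ Finset.range n, (S.filter fun x => rank x % n = t).card :=
      Finset.card_eq_sum_card_fiberwise fun x _ =>
        Finset.mem_coe.2 (Finset.mem_range.2 (Nat.mod_lt _ hn))
    have hlt := Finset.sum_lt_sum_of_nonempty (Finset.nonempty_range_iff.2 hn.ne') hcon
    rw [← Finset.mul_sum, ← hsum, Finset.sum_const, Finset.card_range, smul_eq_mul] at hlt
    exact lt_irrefl _ hlt
  refine ⟨_, Finset.filter_subset _ _, ht, fun P hP hne => ?_⟩
  obtain ⟨p, hp, hpmin⟩ := P.exists_min_image key hne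
  obtain ⟨q, hq, hqmax⟩ := P.exists_max_image key hne
  refine ⟨p, hp, q, hq, ?_⟩
  have hsplit : ∀ x y, key x ≤ key y →
      rank y = rank x + (S.filter fun z => key x ≤ key z ∧ key z < key y).card := by
    intro x y hxy
    rw [hrank]
    dsimp only
    rw [← Finset.card_union_of_disjoint]
    · congr 1
      ext z
      simp only [Finset.mem_filter, Finset.mem_union]
      constructor
      · rintro ⟨hz, hzy⟩
        rcases lt_or_ge (key z) (key x) with h | h
        · exact Or.inl ⟨hz, h⟩
        · exact Or.inr ⟨hz, h, hzy⟩
      · rintro (⟨hz, h⟩ | ⟨hz, -, h⟩)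
        · exact ⟨hz, h.trans_le hxy⟩
        · exact ⟨hz, h⟩
    · rw [Finset.disjoint_left]
      intro z hz hz'
      exact absurd (Finset.mem_filter.1 hz).2 (not_lt.2 (Finset.mem_filter.1 hz').2.1)
  have hmono : ∀ x y, key x ≤ key y → rank x ≤ rank y := fun x y h => by
    rw [hsplit x y h]
    exact Nat.le_add_right _ _
  have hstrict : ∀ x ∈ S, ∀ y, key x < key y → rank x < rank y := fun x hx y h => by
    rw [hsplit x y h.le]
    exact Nat.lt_add_of_pos_right (Finset.card_pos.2 ⟨x, by simp [hx, h]⟩)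
  have hinj : Set.InjOn (fun x => rank x / n) P := by
    intro x hx y hy hxy
    have hx' := Finset.mem_filter.1 (hP hx)
    have hy' := Finset.mem_filter.1 (hP hy)
    have hr : rank x = rank y := by
      rw [← Nat.div_add_mod (rank x) n, ← Nat.div_add_mod (rank y) n, hx'.2, hy'.2]
      simp only at hxy
      rw [hxy]
    refine hkey hx'.1 hy'.1 ?_
    rcases lt_trichotomy (key x) (key y) with h | h | h
    · exact absurd hr (hstrict x hx'.1 y h).ne
    · exact h
    · exact absurd hr (hstrict y hy'.1 x h).ne'
  have hcard : P.card ≤ (Finset.Icc (rank p / n) (rank q / n)).card := by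
    refine Finset.card_le_card_of_injOn _ (fun x hx => ?_) hinj
    rw [Finset.coe_Icc]
    exact ⟨Nat.div_le_div_right (hmono _ _ (hpmin x hx)),
      Nat.div_le_div_right (hmono _ _ (hqmax x hx))⟩
  rw [Nat.card_Icc] at hcard
  have hpq := hsplit p q (hpmin q hq)
  have hle : rank p / n ≤ rank q / n := Nat.div_le_div_right (hmono _ _ (hpmin q hq))
  have h1 := Nat.div_add_mod (rank p) n
  have h2 := Nat.div_add_mod (rank q) n
  rw [(Finset.mem_filter.1 (hP hp)).2] at h1
  rw [(Finset.mem_filter.1 (hP hq)).2] at h2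
  have h3 : P.card + rank p / n ≤ rank q / n + 1 := by omega
  have h4 := Nat.mul_le_mul_left n h3
  rw [Nat.mul_add, Nat.mul_add] at h4
  omega

/-- The coordinate of `x` in the direction of angle `θ`. -/
noncomputable def along (θ : ℝ) (x : EuclideanSpace ℝ (Fin 2)) : ℝ :=
  x 0 * Real.cos θ + x 1 * Real.sin θ

/-- The coordinate of `x` in the direction orthogonal to the angle `θ`. -/
noncomputable def across (θ : ℝ) (x : EuclideanSpace ℝ (Fin 2)) : ℝ :=
  x 1 * Real.cos θ - x 0 * Real.sin θ

theorem dist_sq_coords (x y : EuclideanSpace ℝ (Fin 2)) :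
    dist x y ^ 2 = (x 0 - y 0) ^ 2 + (x 1 - y 1) ^ 2 := by
  rw [EuclideanSpace.dist_eq, Real.sq_sqrt (Finset.sum_nonneg fun i _ => sq_nonneg _)]
  simp [Fin.sum_univ_two, Real.dist_eq, sq_abs]

theorem dist_sq_eq (θ : ℝ) (x y : EuclideanSpace ℝ (Fin 2)) :
    dist x y ^ 2 = (along θ x - along θ y) ^ 2 + (across θ x - across θ y) ^ 2 := by
  rw [dist_sq_coords]
  unfold along across
  linear_combination (-(x 0 - y 0) ^ 2 - (x 1 - y 1) ^ 2) * Real.sin_sq_add_cos_sq θ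

/-- Two angles whose slabs both contain `x` and `y` are close to each other. -/
theorem abs_sub_mul_dist_le {θ φ δ : ℝ} (hθφ : |θ - φ| ≤ Real.pi / 2)
    {x y : EuclideanSpace ℝ (Fin 2)} (hθ : |along θ y - along θ x| ≤ δ)
    (hφ : |along φ y - along φ x| ≤ δ) : |θ - φ| * dist x y ≤ Real.pi * δ := by
  have hδ : 0 ≤ δ := (abs_nonneg _).trans hθ
  set u := along θ y - along θ x with hu
  set w := along φ y - along φ x with hw
  have hsq : (|Real.sin (θ - φ)| * dist x y) ^ 2 ≤ (2 * δ) ^ 2 := by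
    have hid : (|Real.sin (θ - φ)| * dist x y) ^ 2
        = u ^ 2 + w ^ 2 - 2 * u * w * Real.cos (θ - φ) := by
      rw [mul_pow, sq_abs, dist_sq_coords, hu, hw, Real.sin_sub, Real.cos_sub]
      unfold along
      have h1 := Real.sin_sq_add_cos_sq θ
      have h2 := Real.sin_sq_add_cos_sq φ
      have h3 : Real.sin θ ^ 2 = 1 - Real.cos θ ^ 2 := by linarith
      have h4 : Real.sin φ ^ 2 = 1 - Real.cos φ ^ 2 := by linarith
      ring_nf
      simp only [h3, h4]
      ring
    rw [hid]
    have huw : |u * w| ≤ δ * δ := by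
      rw [abs_mul]
      exact mul_le_mul hθ hφ (abs_nonneg _) hδ
    have hc : |u * w * Real.cos (θ - φ)| ≤ δ * δ := by
      rw [abs_mul]
      nlinarith [Real.abs_cos_le_one (θ - φ), abs_nonneg (u * w)]
    have hu2 : u ^ 2 ≤ δ ^ 2 := sq_le_sq' (abs_le.1 hθ).1 (abs_le.1 hθ).2
    have hw2 : w ^ 2 ≤ δ ^ 2 := sq_le_sq' (abs_le.1 hφ).1 (abs_le.1 hφ).2
    nlinarith [(abs_le.1 hc).1]
  have hsin : |Real.sin (θ - φ)| * dist x y ≤ 2 * δ :=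
    le_of_sq_le_sq hsq (by positivity)
  have hjordan : 2 / Real.pi * |θ - φ| ≤ |Real.sin (θ - φ)| :=
    Real.mul_abs_le_abs_sin hθφ
  have hpi := Real.pi_pos
  have h5 : 2 / Real.pi * |θ - φ| * dist x y ≤ 2 * δ :=
    (mul_le_mul_of_nonneg_right hjordan dist_nonneg).trans hsin
  have h6 : Real.pi * (2 / Real.pi * |θ - φ| * dist x y) = 2 * (|θ - φ| * dist x y) := by
    field_simp
  nlinarith [mul_le_mul_of_nonneg_left h5 hpi.le]

/-- A set of natural numbers of diameter at most `D` has at most `D + 1` elements. -/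
theorem card_le_of_forall_abs_sub_le (S : Finset ℕ) (D : ℝ) (hD : 0 ≤ D)
    (h : ∀ m ∈ S, ∀ n ∈ S, |(m : ℝ) - n| ≤ D) : (S.card : ℝ) ≤ D + 1 := by
  rcases S.eq_empty_or_nonempty with rfl | hne
  · simp only [Finset.card_empty, Nat.cast_zero]
    linarith
  have hsub : S ⊆ Finset.Icc (S.min' hne) (S.max' hne) := fun x hx =>
    Finset.mem_Icc.2 ⟨S.min'_le x hx, S.le_max' x hx⟩
  have hcard := Finset.card_le_card hsub
  rw [Nat.card_Icc] at hcard
  have hle : S.min' hne ≤ S.max' hne := S.min'_le _ (S.max'_mem hne)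
  have h1 : S.card + S.min' hne ≤ S.max' hne + 1 := by omega
  have h2 : (S.card : ℝ) + S.min' hne ≤ S.max' hne + 1 := by exact_mod_cast h1
  have h3 := (abs_le.1 (h _ (S.max'_mem hne) _ (S.min'_mem hne))).2
  linarith

/-- The number of equally spaced angles in a sector whose `δ`-slab contains two given points. -/
theorem card_angles_le {δ : ℝ} (hδ : 0 < δ) {M : ℕ} (hM : 1 ≤ M * δ) (θ₀ : ℝ)
    {x y : EuclideanSpace ℝ (Fin 2)} (hxy : dist x y ≤ 2) :
    (((Finset.range M).filter fun m : ℕ =>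
      |along (θ₀ + 2 * Real.pi / 100 * (m / M)) y
        - along (θ₀ + 2 * Real.pi / 100 * (m / M)) x| ≤ δ).card : ℝ)
      ≤ 52 * M * (δ / max δ (dist x y)) := by
  have hM0 : (0 : ℝ) < M := by
    rcases Nat.eq_zero_or_pos M with rfl | h
    · simp at hM
      linarith
    · exact_mod_cast h
  have hpi := Real.pi_pos
  rcases le_or_gt (dist x y) δ with h | h
  · rw [max_eq_left h, div_self hδ.ne']
    have hcard := Finset.card_filter_le (Finset.range M) fun m : ℕ =>
      |along (θ₀ + 2 * Real.pi / 100 * (m / M)) y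
        - along (θ₀ + 2 * Real.pi / 100 * (m / M)) x| ≤ δ
    rw [Finset.card_range] at hcard
    have : (_ : ℝ) ≤ M := Nat.cast_le.2 hcard
    linarith
  · have hd : 0 < dist x y := hδ.trans h
    rw [max_eq_right h.le]
    have hmain := card_le_of_forall_abs_sub_le ((Finset.range M).filter fun m : ℕ =>
      |along (θ₀ + 2 * Real.pi / 100 * (m / M)) y
        - along (θ₀ + 2 * Real.pi / 100 * (m / M)) x| ≤ δ) (50 * M * (δ / dist x y))
      (by positivity) ?_
    · have hone : 1 ≤ 2 * M * (δ / dist x y) := by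
        rw [← mul_div_assoc, le_div_iff₀ hd]
        linarith
      linarith
    · intro m hm n hn
      obtain ⟨hmM, hm⟩ := Finset.mem_filter.1 hm
      obtain ⟨hnM, hn⟩ := Finset.mem_filter.1 hn
      have hmM' : (m : ℝ) ≤ M := by exact_mod_cast (Finset.mem_range.1 hmM).le
      have hnM' : (n : ℝ) ≤ M := by exact_mod_cast (Finset.mem_range.1 hnM).le
      have hdiff : |(θ₀ + 2 * Real.pi / 100 * (m / M)) - (θ₀ + 2 * Real.pi / 100 * (n / M))|
          = 2 * Real.pi / 100 / M * |(m : ℝ) - n| := by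
        have hs : 0 < 2 * Real.pi / 100 / M := by positivity
        have heq : (θ₀ + 2 * Real.pi / 100 * (m / M)) - (θ₀ + 2 * Real.pi / 100 * (n / M))
            = 2 * Real.pi / 100 / M * ((m : ℝ) - n) := by ring
        rw [heq, abs_mul, abs_of_pos hs]
      have hmn : |(m : ℝ) - n| ≤ M := by
        rw [abs_le]
        constructor <;> linarith [Nat.cast_nonneg (α := ℝ) m, Nat.cast_nonneg (α := ℝ) n]
      have hsmall : 2 * Real.pi / 100 / M * |(m : ℝ) - n| ≤ Real.pi / 2 := by
        calc 2 * Real.pi / 100 / M * |(m : ℝ) - n| ≤ 2 * Real.pi / 100 / M * M := by gcongr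
          _ = 2 * Real.pi / 100 := by field_simp
          _ ≤ Real.pi / 2 := by linarith
      have hkey := abs_sub_mul_dist_le (hdiff ▸ hsmall) hm hn
      rw [hdiff] at hkey
      rw [← mul_div_assoc, le_div_iff₀ hd]
      have heq : 2 * Real.pi / 100 / M * |(m : ℝ) - n| * dist x y
          = Real.pi * (|(m : ℝ) - n| * dist x y / (50 * M)) := by
        field_simp
        ring
      rw [heq] at hkey
      have := le_of_mul_le_mul_left hkey hpi
      rw [div_le_iff₀ (by positivity)] at this
      linarith

/-- Inside the unit square the Katz–Tao bound holds at all scales at least `δ`. -/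
theorem IsKatzTaoSet.card_filter_le {δ α C₀ : ℝ} (hδ : 0 < δ) (hδ1 : δ ≤ 1) (hα : 0 ≤ α)
    (hC₀ : 0 ≤ C₀) {X : Finset (EuclideanSpace ℝ (Fin 2))}
    (hX : ∀ z ∈ X, ∀ i : Fin 2, z i ∈ Set.Icc (0 : ℝ) 1)
    (hKT : IsKatzTaoSet δ α C₀ (X : Set (EuclideanSpace ℝ (Fin 2))))
    (x : EuclideanSpace ℝ (Fin 2)) {r : ℝ} (hr : δ ≤ r) :
    ((X.filter fun y => dist x y ≤ r).card : ℝ) ≤ C₀ * (r / δ) ^ α := by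
  rcases le_or_gt r 1 with h1 | h1
  · refine le_trans (le_of_eq ?_) (hKT x r hr h1)
    rw [← Set.ncard_coe_finset]
    congr 2
    ext y
    simp [dist_comm]
  · have hball : (X : Set (EuclideanSpace ℝ (Fin 2))) ∩ closedBall !₂[1 / 2, 1 / 2] 1 = X := by
      refine Set.inter_eq_left.2 fun y hy => ?_
      have h0 := hX y hy 0
      have h1 := hX y hy 1
      rw [mem_closedBall]
      refine le_of_sq_le_sq ?_ zero_le_one
      rw [dist_sq_coords]
      simp
      nlinarith [h0.1, h0.2, h1.1, h1.2]
    have h := hKT !₂[1 / 2, 1 / 2] 1 hδ1 le_rfl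
    rw [hball, Set.ncard_coe_finset] at h
    calc ((X.filter fun y => dist x y ≤ r).card : ℝ) ≤ X.card :=
          Nat.cast_le.2 (Finset.card_filter_le _ _)
      _ ≤ C₀ * (1 / δ) ^ α := h
      _ ≤ C₀ * (r / δ) ^ α := by gcongr

/-- Logarithmic energy bound: the critical energy of a Katz–Tao set is at most logarithmic. -/
theorem IsKatzTaoSet.sum_energy_le {δ α C₀ : ℝ} (hδ : 0 < δ) (hδ1 : δ ≤ 1) (hα : 0 ≤ α)
    (hα2 : α ≤ 2) (hC₀ : 0 ≤ C₀) {X : Finset (EuclideanSpace ℝ (Fin 2))}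
    (hX : ∀ z ∈ X, ∀ i : Fin 2, z i ∈ Set.Icc (0 : ℝ) 1)
    (hKT : IsKatzTaoSet δ α C₀ (X : Set (EuclideanSpace ℝ (Fin 2))))
    (x : EuclideanSpace ℝ (Fin 2)) {J : ℕ} (hJ : 2 ≤ 2 ^ J * δ) (hx : ∀ y ∈ X, dist x y ≤ 2) :
    ∑ y ∈ X, (δ / max δ (dist x y)) ^ α ≤ 4 * C₀ * (J + 1) := by
  have hpoint : ∀ y ∈ X, (δ / max δ (dist x y)) ^ α ≤
      ∑ j ∈ Finset.range (J + 1), if dist x y ≤ 2 ^ j * δ then 4 * ((1 / 2 ^ j : ℝ)) ^ α else 0 := by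
    intro y hy
    have hex : ∃ j : ℕ, dist x y ≤ 2 ^ j * δ := ⟨J, (hx y hy).trans hJ⟩
    have hj := Nat.find_spec hex
    have hjJ : Nat.find hex ≤ J := Nat.find_min' hex ((hx y hy).trans hJ)
    have hmin := fun i => Nat.find_min hex (m := i)
    set j := Nat.find hex with hjdef
    have hbound : (δ / max δ (dist x y)) ^ α ≤ 4 * ((1 / 2 ^ j : ℝ)) ^ α := by
      have hle : δ / max δ (dist x y) ≤ 2 * (1 / 2 ^ j) := by
        have hpos : 0 < max δ (dist x y) := lt_max_of_lt_left hδ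
        rcases Nat.eq_zero_or_pos j with h0 | h0
        · rw [h0, pow_zero, div_le_iff₀ hpos]
          linarith [le_max_left δ (dist x y)]
        · have hlt := not_le.1 (hmin (j - 1) (by omega))
          have hpow : (2 : ℝ) ^ j = 2 * 2 ^ (j - 1) := by
            rw [← pow_succ']
            congr 1
            omega
          rw [hpow, div_le_iff₀ hpos]
          have h2 : (0 : ℝ) < 2 ^ (j - 1) := by positivity
          have h3 : 2 * (1 / (2 * (2 : ℝ) ^ (j - 1))) * max δ (dist x y)
              = max δ (dist x y) / 2 ^ (j - 1) := by
            field_simp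
          rw [h3, le_div_iff₀ h2]
          linarith [le_max_right δ (dist x y)]
      calc (δ / max δ (dist x y)) ^ α ≤ (2 * (1 / 2 ^ j)) ^ α := by
            gcongr
        _ = 2 ^ α * (1 / 2 ^ j) ^ α := Real.mul_rpow (by norm_num) (by positivity)
        _ ≤ 4 * (1 / 2 ^ j) ^ α := by
            gcongr
            calc (2 : ℝ) ^ α ≤ 2 ^ (2 : ℝ) := Real.rpow_le_rpow_of_exponent_le one_le_two hα2
              _ = 4 := by norm_num
    refine hbound.trans ?_
    have hs := Finset.single_le_sum
      (f := fun j : ℕ => if dist x y ≤ 2 ^ j * δ then 4 * ((1 / 2 ^ j : ℝ)) ^ α else 0)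
      (fun i _ => by split_ifs <;> positivity)
      (Finset.mem_range.2 (Nat.lt_succ_of_le hjJ))
    rwa [if_pos hj] at hs
  calc ∑ y ∈ X, (δ / max δ (dist x y)) ^ α
      ≤ ∑ y ∈ X, ∑ j ∈ Finset.range (J + 1),
          if dist x y ≤ 2 ^ j * δ then 4 * ((1 / 2 ^ j : ℝ)) ^ α else 0 :=
        Finset.sum_le_sum hpoint
    _ = ∑ j ∈ Finset.range (J + 1), ∑ y ∈ X,
          if dist x y ≤ 2 ^ j * δ then 4 * ((1 / 2 ^ j : ℝ)) ^ α else 0 := Finset.sum_comm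
    _ ≤ ∑ j ∈ Finset.range (J + 1), 4 * C₀ := by
        refine Finset.sum_le_sum fun j _ => ?_
        rw [← Finset.sum_filter, Finset.sum_const, nsmul_eq_mul]
        have h1 : (1 : ℝ) ≤ 2 ^ j := one_le_pow₀ one_le_two
        have hc := IsKatzTaoSet.card_filter_le hδ hδ1 hα hC₀ hX hKT x
          (r := 2 ^ j * δ) (by nlinarith)
        rw [mul_div_assoc, div_self hδ.ne', mul_one] at hc
        calc _ ≤ C₀ * ((2 : ℝ) ^ j) ^ α * (4 * (1 / 2 ^ j) ^ α) := by gcongr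
          _ = 4 * C₀ * (((2 : ℝ) ^ j) ^ α * (1 / 2 ^ j) ^ α) := by ring
          _ = 4 * C₀ := by
            rw [← Real.mul_rpow (by positivity) (by positivity), mul_one_div_cancel (by positivity),
              Real.one_rpow, mul_one]
    _ = 4 * C₀ * (J + 1) := by
        rw [Finset.sum_const, Finset.card_range, nsmul_eq_mul]
        push_cast
        ring

/-- The energy at exponent `β` of the part of `X` in the slab of angle `θ` around `x`. -/
noncomputable def slabEnergy (δ β θ : ℝ) (X : Finset (EuclideanSpace ℝ (Fin 2)))
    (x : EuclideanSpace ℝ (Fin 2)) : ℝ :=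
  ∑ y ∈ X, if |along θ y - along θ x| ≤ δ then (δ / max δ (dist x y)) ^ β else 0

theorem slabEnergy_nonneg {δ : ℝ} (hδ : 0 < δ) (β θ : ℝ)
    (X : Finset (EuclideanSpace ℝ (Fin 2))) (x : EuclideanSpace ℝ (Fin 2)) :
    0 ≤ slabEnergy δ β θ X x := by
  have hpos : ∀ y, 0 < max δ (dist x y) := fun y => lt_max_of_lt_left hδ
  refine Finset.sum_nonneg fun y _ => ?_
  have := hpos y
  split_ifs <;> positivity

/-- The slab energy controls the number of points in the slab at every scale. -/
theorem card_le_slabEnergy {δ β θ : ℝ} (hδ : 0 < δ) (hβ : 0 ≤ β)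
    {X T : Finset (EuclideanSpace ℝ (Fin 2))} {x : EuclideanSpace ℝ (Fin 2)} {r : ℝ} (hr : δ ≤ r)
    (hTX : T ⊆ X) (hslab : ∀ y ∈ T, |along θ y - along θ x| ≤ δ) (hdist : ∀ y ∈ T, dist x y ≤ r) :
    (T.card : ℝ) ≤ slabEnergy δ β θ X x * (r / δ) ^ β := by
  have hr0 : 0 < r := hδ.trans_le hr
  have hpos : ∀ y, 0 < max δ (dist x y) := fun y => lt_max_of_lt_left hδ
  have h1 : ∑ _y ∈ T, (δ / r) ^ β ≤ slabEnergy δ β θ X x := by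
    calc ∑ _y ∈ T, (δ / r) ^ β
        ≤ ∑ y ∈ T, if |along θ y - along θ x| ≤ δ then (δ / max δ (dist x y)) ^ β else 0 := by
          refine Finset.sum_le_sum fun y hy => ?_
          rw [if_pos (hslab y hy)]
          have := hpos y
          have := max_le hr (hdist y hy)
          gcongr
      _ ≤ _ := by
          refine Finset.sum_le_sum_of_subset_of_nonneg hTX fun y _ _ => ?_
          have := hpos y
          split_ifs <;> positivity
  rw [Finset.sum_const, nsmul_eq_mul] at h1
  calc (T.card : ℝ) = T.card * (δ / r) ^ β * (r / δ) ^ β := by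
        rw [mul_assoc, ← Real.mul_rpow (by positivity) (by positivity),
          div_mul_div_cancel₀ hr0.ne', div_self hδ.ne', Real.one_rpow, mul_one]
    _ ≤ _ := by gcongr

/-- Some angle in any sector of width `2π / 100` has small total slab energy. -/
theorem IsKatzTaoSet.exists_angle {δ α C₀ : ℝ} (hδ : 0 < δ) (hδ1 : δ ≤ 1) (hα : 1 < α)
    (hα2 : α ≤ 2) (hC₀ : 0 ≤ C₀) {X : Finset (EuclideanSpace ℝ (Fin 2))}
    (hX : ∀ z ∈ X, ∀ i : Fin 2, z i ∈ Set.Icc (0 : ℝ) 1)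
    (hKT : IsKatzTaoSet δ α C₀ (X : Set (EuclideanSpace ℝ (Fin 2))))
    {J : ℕ} (hJ : 2 ≤ 2 ^ J * δ) (θ₀ : ℝ) :
    ∃ θ ∈ Set.Icc θ₀ (θ₀ + 2 * Real.pi / 100),
      ∑ x ∈ X, slabEnergy δ (α - 1) θ X x ≤ 208 * C₀ * (J + 1) * X.card := by
  have hdist : ∀ x ∈ X, ∀ y ∈ X, dist x y ≤ 2 := by
    intro x hx y hy
    refine le_of_sq_le_sq ?_ zero_le_two
    rw [dist_sq_coords]
    have hx0 := hX x hx 0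
    have hx1 := hX x hx 1
    have hy0 := hX y hy 0
    have hy1 := hX y hy 1
    have h0 : (x 0 - y 0) ^ 2 ≤ 1 := by
      rw [sq_le_one_iff_abs_le_one, abs_le]
      constructor <;> linarith [hx0.1, hx0.2, hy0.1, hy0.2]
    have h1 : (x 1 - y 1) ^ 2 ≤ 1 := by
      rw [sq_le_one_iff_abs_le_one, abs_le]
      constructor <;> linarith [hx1.1, hx1.2, hy1.1, hy1.2]
    linarith
  obtain ⟨M, hM⟩ := exists_nat_ge (1 / δ)
  rw [div_le_iff₀ hδ] at hM
  have hM0 : 0 < M := by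
    rcases Nat.eq_zero_or_pos M with rfl | h
    · simp at hM
      linarith
    · exact h
  have hM0' : (0 : ℝ) < M := by exact_mod_cast hM0
  have hpi := Real.pi_pos
  set ang : ℕ → ℝ := fun m => θ₀ + 2 * Real.pi / 100 * (m / M) with hang
  have htotal : ∑ m ∈ Finset.range M, ∑ x ∈ X, slabEnergy δ (α - 1) (ang m) X x
      ≤ ∑ _m ∈ Finset.range M, 208 * C₀ * (J + 1) * X.card := by
    rw [Finset.sum_comm, Finset.sum_const, Finset.card_range, nsmul_eq_mul]
    calc ∑ x ∈ X, ∑ m ∈ Finset.range M, slabEnergy δ (α - 1) (ang m) X x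
        ≤ ∑ _x ∈ X, M * (208 * C₀ * (J + 1)) := ?_
      _ = M * (208 * C₀ * (J + 1) * X.card) := by
          rw [Finset.sum_const, nsmul_eq_mul]
          ring
    refine Finset.sum_le_sum fun x hx => ?_
    unfold slabEnergy
    rw [Finset.sum_comm]
    calc _ ≤ ∑ y ∈ X, 52 * M * (δ / max δ (dist x y)) ^ α := ?_
      _ = 52 * M * ∑ y ∈ X, (δ / max δ (dist x y)) ^ α := by rw [Finset.mul_sum]
      _ ≤ 52 * M * (4 * C₀ * (J + 1)) := by
          gcongr
          exact IsKatzTaoSet.sum_energy_le hδ hδ1 (by linarith) hα2 hC₀ hX hKT x hJ (hdist x hx)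
      _ = M * (208 * C₀ * (J + 1)) := by ring
    refine Finset.sum_le_sum fun y hy => ?_
    have hpos : 0 < δ / max δ (dist x y) := div_pos hδ (lt_max_of_lt_left hδ)
    rw [← Finset.sum_filter, Finset.sum_const, nsmul_eq_mul]
    calc _ ≤ 52 * M * (δ / max δ (dist x y)) * (δ / max δ (dist x y)) ^ (α - 1) := by
          gcongr
          exact card_angles_le hδ hM θ₀ (hdist x hx y hy)
      _ = 52 * M * (δ / max δ (dist x y)) ^ α := by
          rw [Real.rpow_sub_one hpos.ne']
          field_simp
  obtain ⟨m, hm, hle⟩ := Finset.exists_le_of_sum_le (Finset.nonempty_range_iff.2 hM0.ne') htotal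
  have hmM : (m : ℝ) / M ≤ 1 := by
    rw [div_le_one hM0']
    exact_mod_cast (Finset.mem_range.1 hm).le
  refine ⟨ang m, ⟨?_, ?_⟩, hle⟩
  · rw [hang]
    have : 0 ≤ 2 * Real.pi / 100 * (m / M) := by positivity
    linarith
  · rw [hang]
    have : 2 * Real.pi / 100 * (m / M) ≤ 2 * Real.pi / 100 * 1 := by gcongr
    linarith

/-- A set of points of bounded slab energy can be thinned so that its slices are Katz–Tao. -/
theorem exists_thin_subset {δ β θ K : ℝ} (hδ : 0 < δ) (hβ : 0 ≤ β) (hβ1 : β ≤ 1) (hK : 1 ≤ K)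
    (S : Finset (EuclideanSpace ℝ (Fin 2))) (hS : ∀ x ∈ S, slabEnergy δ β θ S x ≤ K) :
    ∃ S' ⊆ S, (S.card : ℝ) ≤ 2 * K * S'.card ∧
      ∀ a : ℝ, IsKatzTaoSet δ β 8 {x ∈ (S' : Set (EuclideanSpace ℝ (Fin 2))) |
        x 0 * Real.cos θ + x 1 * Real.sin θ ∈ Set.Icc a (a + δ)} := by
  classical
  set key : EuclideanSpace ℝ (Fin 2) → ℤ ×ₗ (ℝ ×ₗ ℝ) := fun x =>
    toLex (⌊along θ x / δ⌋, toLex (across θ x, along θ x)) with hkeydef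
  have hkey : Set.InjOn key S := by
    intro x _ y _ hxy
    have h1 := congrArg (fun z => (ofLex (ofLex z).2).1) hxy
    have h2 := congrArg (fun z => (ofLex (ofLex z).2).2) hxy
    simp only [hkeydef, ofLex_toLex] at h1 h2
    have hd := dist_sq_eq θ x y
    rw [h1, h2, sub_self, sub_self] at hd
    refine dist_eq_zero.1 (pow_eq_zero_iff two_ne_zero |>.1 ?_)
    rw [hd]
    ring
  have hn : 0 < ⌈K⌉₊ := Nat.ceil_pos.2 (by linarith)
  have hKn : K ≤ ⌈K⌉₊ := Nat.le_ceil K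
  have hn2 : (⌈K⌉₊ : ℝ) ≤ 2 * K := by linarith [Nat.ceil_lt_add_one (show 0 ≤ K by linarith)]
  have hn0 : (0 : ℝ) < ⌈K⌉₊ := by exact_mod_cast hn
  obtain ⟨S', hS'S, hcard, hsparse⟩ := exists_sparse_subset S key hkey ⌈K⌉₊ hn
  refine ⟨S', hS'S, ?_, fun a z r hr _ => ?_⟩
  · have h : (S.card : ℝ) ≤ ⌈K⌉₊ * S'.card := by exact_mod_cast hcard
    exact h.trans (by gcongr)
  have hr0 : 0 < r := hδ.trans_le hr
  have hrδ : 1 ≤ (r / δ) ^ β := Real.one_le_rpow ((one_le_div hδ).2 hr) hβ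
  have hslab : ∀ k : ℤ, ((S'.filter fun x => ⌊along θ x / δ⌋ = k ∧ dist x z ≤ r).card : ℝ)
      ≤ 4 * (r / δ) ^ β := by
    intro k
    set P := S'.filter fun x => ⌊along θ x / δ⌋ = k ∧ dist x z ≤ r with hP
    rcases P.eq_empty_or_nonempty with he | hne
    · rw [he, Finset.card_empty, Nat.cast_zero]
      positivity
    obtain ⟨p, hp, q, hq, hpq⟩ := hsparse P (Finset.filter_subset _ _) hne
    set T := S.filter fun y => key p ≤ key y ∧ key y < key q with hT
    obtain ⟨hpS', hpk, hpz⟩ := Finset.mem_filter.1 hp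
    obtain ⟨-, hqk, hqz⟩ := Finset.mem_filter.1 hq
    have hTspec : ∀ y ∈ T, |along θ y - along θ p| ≤ δ ∧ across θ p ≤ across θ y ∧
        across θ y ≤ across θ q := by
      intro y hy
      obtain ⟨-, h1, h2⟩ := Finset.mem_filter.1 hy
      replace h2 := h2.le
      simp only [hkeydef, Prod.Lex.toLex_le_toLex, hpk, hqk] at h1 h2
      have hyk : ⌊along θ y / δ⌋ = k := by
        rcases h1 with h1 | h1 <;> rcases h2 with h2 | h2 <;> omega
      simp only [hyk, lt_irrefl, false_or, true_and] at h1 h2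
      refine ⟨?_, ?_, ?_⟩
      · have h3 := Int.abs_sub_lt_one_of_floor_eq_floor (hyk.trans hpk.symm)
        rw [← sub_div, abs_div, abs_of_pos hδ, div_lt_one hδ] at h3
        exact h3.le
      · rcases h1 with h1 | h1
        · exact h1.le
        · exact h1.1.le
      · rcases h2 with h2 | h2
        · exact h2.le
        · exact h2.1.le
    have hpq2 : across θ q - across θ p ≤ 2 * r := by
      have hd : dist q p ≤ 2 * r := by linarith [dist_triangle_right q p z]
      refine (le_abs_self _).trans (le_trans (le_of_sq_le_sq ?_ dist_nonneg) hd)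
      rw [sq_abs, dist_sq_eq θ q p]
      linarith [sq_nonneg (along θ q - along θ p)]
    have hTdist : ∀ y ∈ T, dist p y ≤ 3 * r := by
      intro y hy
      obtain ⟨h1, h2, h3⟩ := hTspec y hy
      refine le_of_sq_le_sq ?_ (by positivity)
      rw [dist_comm, dist_sq_eq θ y p]
      have h4 : (along θ y - along θ p) ^ 2 ≤ r ^ 2 :=
        sq_le_sq' (by linarith [(abs_le.1 h1).1]) (by linarith [(abs_le.1 h1).2])
      have h5 : (across θ y - across θ p) ^ 2 ≤ (2 * r) ^ 2 :=
        sq_le_sq' (by linarith) (by linarith)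
      nlinarith
    have hTcard := card_le_slabEnergy (β := β) hδ hβ (r := 3 * r) (by linarith)
      (Finset.filter_subset _ _ : T ⊆ S) (fun y hy => (hTspec y hy).1) hTdist
    have h3 : (3 * r / δ) ^ β ≤ 3 * (r / δ) ^ β := by
      rw [mul_div_assoc, Real.mul_rpow (by norm_num) (by positivity)]
      gcongr
      calc (3 : ℝ) ^ β ≤ 3 ^ (1 : ℝ) := Real.rpow_le_rpow_of_exponent_le (by norm_num) hβ1
        _ = 3 := Real.rpow_one 3
    have hT2 : (T.card : ℝ) ≤ ⌈K⌉₊ * (3 * (r / δ) ^ β) := by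
      refine hTcard.trans ?_
      have := (hS p (hS'S hpS')).trans hKn
      gcongr
    have hpq' : (⌈K⌉₊ : ℝ) * P.card ≤ T.card + ⌈K⌉₊ := by exact_mod_cast hpq
    have : (⌈K⌉₊ : ℝ) * P.card ≤ ⌈K⌉₊ * (4 * (r / δ) ^ β) := by nlinarith
    exact le_of_mul_le_mul_left this hn0
  have hcover : {x ∈ (S' : Set (EuclideanSpace ℝ (Fin 2))) |
        x 0 * Real.cos θ + x 1 * Real.sin θ ∈ Set.Icc a (a + δ)} ∩ closedBall z r ⊆
      ↑((S'.filter fun x => ⌊along θ x / δ⌋ = ⌊a / δ⌋ ∧ dist x z ≤ r) ∪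
        (S'.filter fun x => ⌊along θ x / δ⌋ = ⌊a / δ⌋ + 1 ∧ dist x z ≤ r)) := by
    rintro x ⟨⟨hxS, hx1, hx2⟩, hxz⟩
    rw [mem_closedBall] at hxz
    change a ≤ along θ x at hx1
    change along θ x ≤ a + δ at hx2
    have h1 : ⌊a / δ⌋ ≤ ⌊along θ x / δ⌋ := Int.floor_le_floor (by gcongr)
    have h2 : ⌊along θ x / δ⌋ ≤ ⌊a / δ⌋ + 1 := by
      rw [← Int.floor_add_one]
      refine Int.floor_le_floor ?_
      rw [div_add_one hδ.ne']
      gcongr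
    rw [Finset.coe_union]
    rcases (show ⌊along θ x / δ⌋ = ⌊a / δ⌋ ∨ ⌊along θ x / δ⌋ = ⌊a / δ⌋ + 1 by omega) with h | h
    · exact Or.inl (Finset.mem_coe.2 (Finset.mem_filter.2 ⟨hxS, h, hxz⟩))
    · exact Or.inr (Finset.mem_coe.2 (Finset.mem_filter.2 ⟨hxS, h, hxz⟩))
  have hncard := (Set.ncard_le_ncard hcover (Finset.finite_toSet _)).trans
    ((Set.ncard_coe_finset _).le.trans (Finset.card_union_le _ _))
  have hncard' : (_ : ℝ) ≤ _ := Nat.cast_le.2 hncard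
  rw [Nat.cast_add] at hncard'
  linarith [hslab ⌊a / δ⌋, hslab (⌊a / δ⌋ + 1)]

/-- The number of dyadic scales between `δ` and `2` is at most a constant times `δ⁻¹ ^ ε`. -/
theorem exists_num_scales {ε δ : ℝ} (hε : 0 < ε) (hδ : 0 < δ) (hδ1 : δ ≤ 1) :
    ∃ J : ℕ, 2 ≤ 2 ^ J * δ ∧ ((J : ℝ) + 1) * δ ^ ε ≤ 4 + 2 / ε := by
  have hlog2 : 1 / 2 < Real.log 2 := by linarith [Real.log_two_gt_d9]
  have hlog2' : Real.log 2 < 1 := by linarith [Real.log_two_lt_d9]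
  have hlogδ : Real.log (2 / δ) = Real.log 2 + Real.log δ⁻¹ := by
    rw [div_eq_mul_inv, Real.log_mul two_ne_zero (inv_ne_zero hδ.ne')]
  have hlogδ0 : 0 ≤ Real.log δ⁻¹ := Real.log_nonneg ((one_le_inv₀ hδ).2 hδ1)
  refine ⟨⌈2 * Real.log (2 / δ)⌉₊, ?_, ?_⟩
  · rw [← div_le_iff₀ hδ, ← Real.log_le_log_iff (by positivity) (by positivity), Real.log_pow]
    have := Nat.le_ceil (2 * Real.log (2 / δ))
    nlinarith [Nat.cast_nonneg (α := ℝ) ⌈2 * Real.log (2 / δ)⌉₊]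
  · have hceil := (Nat.ceil_lt_add_one (show 0 ≤ 2 * Real.log (2 / δ) by linarith)).le
    have hlog := Real.log_le_rpow_div (inv_nonneg.2 hδ.le) hε
    have hδε : 0 < δ ^ ε := Real.rpow_pos_of_pos hδ ε
    have hδε1 : δ ^ ε ≤ 1 := Real.rpow_le_one hδ.le hδ1 hε.le
    rw [Real.inv_rpow hδ.le] at hlog
    calc _ ≤ (4 + 2 * ((δ ^ ε)⁻¹ / ε)) * δ ^ ε := by
          refine mul_le_mul_of_nonneg_right ?_ hδε.le
          linarith
      _ = 4 * δ ^ ε + 2 / ε := by field_simp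
      _ ≤ 4 + 2 / ε := by linarith

/-- Discretized slicing: for a Katz–Tao `(δ,α,C₀)`-set `X` in `[0,1]²` and each of the 100
sectors of directions, there are a direction `θ` in the sector and a large subset `X' ⊆ X`
such that every `δ`-slab perpendicular to `(cos θ, sin θ)` meets `X'` in a Katz–Tao
`(δ,α-1,C')`-set. -/
theorem stmt13 (α : ℝ) (hα1 : 1 < α) (hα2 : α ≤ 2) (C₀ : ℝ) (hC₀ : 1 ≤ C₀)
    (ε : ℝ) (hε : 0 < ε) :
    ∃ c C' δ₀ : ℝ, 0 < c ∧ 0 < C' ∧ 0 < δ₀ ∧ δ₀ < 1 ∧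
      ∀ δ : ℝ, 0 < δ → δ < δ₀ →
      ∀ X : Finset (EuclideanSpace ℝ (Fin 2)), InLattice δ X →
        (∀ z ∈ X, ∀ i : Fin 2, z i ∈ Set.Icc (0 : ℝ) 1) →
        IsKatzTaoSet δ α C₀ (X : Set (EuclideanSpace ℝ (Fin 2))) →
      ∀ i : ℕ, i < 100 →
        ∃ θ : ℝ, θ ∈ Set.Icc (2 * Real.pi * i / 100) (2 * Real.pi * (i + 1) / 100) ∧
        ∃ X' : Finset (EuclideanSpace ℝ (Fin 2)), X' ⊆ X ∧
          c * δ ^ ε * (X.card : ℝ) ≤ (X'.card : ℝ) ∧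
          ∀ a : ℝ, IsKatzTaoSet δ (α - 1) C'
            {x ∈ (X' : Set (EuclideanSpace ℝ (Fin 2))) |
              x 0 * Real.cos θ + x 1 * Real.sin θ ∈ Set.Icc a (a + δ)} := by
  refine ⟨1 / (1664 * C₀ * (4 + 2 / ε)), 8, 1 / 2, by positivity, by norm_num, by norm_num,
    by norm_num, fun δ hδ hδ2 X _ hX hKT i _ => ?_⟩
  have hδ1 : δ ≤ 1 := by linarith
  obtain ⟨J, hJ, hJε⟩ := exists_num_scales hε hδ hδ1
  obtain ⟨θ, hθ, hsum⟩ := IsKatzTaoSet.exists_angle hδ hδ1 hα1 hα2 (by linarith) hX hKT hJ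
    (2 * Real.pi * i / 100)
  set K := 416 * C₀ * ((J : ℝ) + 1) with hKdef
  have hK1 : 1 ≤ K := by
    have : (0 : ℝ) ≤ J := Nat.cast_nonneg J
    nlinarith
  set S := X.filter fun x => slabEnergy δ (α - 1) θ X x ≤ K with hS
  have hScard : (X.card : ℝ) ≤ 2 * S.card := by
    have hbad : K * (X.filter fun x => ¬ slabEnergy δ (α - 1) θ X x ≤ K).card
        ≤ ∑ x ∈ X, slabEnergy δ (α - 1) θ X x := by
      rw [mul_comm, ← nsmul_eq_mul, ← Finset.sum_const]
      refine (Finset.sum_le_sum fun x hx => (not_le.1 (Finset.mem_filter.1 hx).2).le).trans ?_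
      exact Finset.sum_le_sum_of_subset_of_nonneg (Finset.filter_subset _ _)
        fun x _ _ => slabEnergy_nonneg hδ _ _ _ _
    have hsplit : (S.card : ℝ) + (X.filter fun x => ¬ slabEnergy δ (α - 1) θ X x ≤ K).card
        = X.card := by
      exact_mod_cast Finset.card_filter_add_card_filter_not _
    have h : K * (X.filter fun x => ¬ slabEnergy δ (α - 1) θ X x ≤ K).card
        ≤ K * (X.card / 2) := by
      refine hbad.trans (hsum.trans (le_of_eq ?_))
      rw [hKdef]
      ring
    linarith [le_of_mul_le_mul_left h (by linarith)]
  have hSenergy : ∀ x ∈ S, slabEnergy δ (α - 1) θ S x ≤ K := fun x hx =>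
    (Finset.sum_le_sum_of_subset_of_nonneg (Finset.filter_subset _ _) fun y _ _ => by
      have : 0 < max δ (dist x y) := lt_max_of_lt_left hδ
      split_ifs <;> positivity).trans (Finset.mem_filter.1 hx).2
  obtain ⟨X', hX'S, hcard, hslices⟩ := exists_thin_subset hδ (by linarith) (by linarith) hK1 S
    hSenergy
  refine ⟨θ, ⟨hθ.1, hθ.2.trans (le_of_eq (by ring))⟩, X',
    hX'S.trans (Finset.filter_subset _ _), ?_, hslices⟩
  have hδε : 0 < δ ^ ε := Real.rpow_pos_of_pos hδ ε
  rw [one_div, mul_assoc, inv_mul_le_iff₀ (by positivity)]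
  calc δ ^ ε * (X.card : ℝ) ≤ δ ^ ε * (2 * (2 * K * X'.card)) := by
        gcongr
        linarith
    _ = 1664 * C₀ * (((J : ℝ) + 1) * δ ^ ε) * X'.card := by
        rw [hKdef]
        ring
    _ ≤ _ := by gcongr
end
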